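/- arXiv:1701.02234 — 5 statements merged into one kernel-verified Lean document; each statement's English description precedes it below -/
import Mathlib

section
/- Let (X_n)_{n≥1} be a sequence of pairwise independent, integrable real-valued random variables. Suppose there exist a random variable X with E|X| < ∞ and a constant C > 0 such that sup_{n≥1} (1/n) ∑_{k=1}^{n} P(|X_k| > x) ≤ C · P(|X| > x) for all x ≥ 0. Then (S_n − E S_n)/n → 0 almost surely, where S_n = ∑_{k=1}^{n} X_k. -/
open MeasureTheory ProbabilityTheory Filter ENNReal

/-- If the superlevel sets of `φ` on `[0, ∞)` at positive levels are empty or of the form `(b, ∞)`,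
then a domination of the sum of the tails of `Z k` by a multiple of the tail of `Y` passes to the
expectations of `φ ∘ Z k` and `φ ∘ Y`. -/
lemma sum_integral_comp_le_of_sum_tail_le {Ω ι : Type*} [MeasurableSpace Ω] {μ : Measure Ω}
    {s : Finset ι} {Z : ι → Ω → ℝ} {Y : Ω → ℝ} {a : ℝ} (ha : 0 ≤ a)
    (hZ0 : ∀ k ω, 0 ≤ Z k ω) (hY0 : ∀ ω, 0 ≤ Y ω)
    (hdom : ∀ x : ℝ, 0 ≤ x →
      ∑ k ∈ s, μ {ω | x < Z k ω} ≤ ENNReal.ofReal a * μ {ω | x < Y ω})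
    {φ : ℝ → ℝ} (hφ0 : ∀ x, 0 ≤ φ x)
    (hφ : ∀ t, 0 < t → (∀ x, 0 ≤ x → ¬ t < φ x) ∨ ∃ b, 0 ≤ b ∧ ∀ x, 0 ≤ x → (t < φ x ↔ b < x))
    (hZφ : ∀ k ∈ s, Integrable (fun ω => φ (Z k ω)) μ)
    (hYφ : Integrable (fun ω => φ (Y ω)) μ) :
    ∑ k ∈ s, ∫ ω, φ (Z k ω) ∂μ ≤ a * ∫ ω, φ (Y ω) ∂μ := by
  have layer : ∀ W : Ω → ℝ, Integrable (fun ω => φ (W ω)) μ →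
      ENNReal.ofReal (∫ ω, φ (W ω) ∂μ) = ∫⁻ t in Set.Ioi (0 : ℝ), μ {ω | t < φ (W ω)} := by
    intro W hW
    rw [ofReal_integral_eq_lintegral_ofReal hW (ae_of_all _ fun ω => hφ0 _)]
    exact lintegral_eq_lintegral_meas_lt μ (ae_of_all _ fun ω => hφ0 _) hW.aemeasurable
  have meas : ∀ W : Ω → ℝ, Measurable fun t : ℝ => μ {ω | t < φ (W ω)} := fun W =>
    Antitone.measurable fun t t' htt' => measure_mono fun ω hω => lt_of_le_of_lt htt' hω
  have hI : 0 ≤ ∫ ω, φ (Y ω) ∂μ := integral_nonneg fun ω => hφ0 _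
  rw [← ENNReal.ofReal_le_ofReal_iff (mul_nonneg ha hI), ENNReal.ofReal_mul ha, layer Y hYφ,
    ENNReal.ofReal_sum_of_nonneg fun k _ => integral_nonneg fun ω => hφ0 _,
    Finset.sum_congr rfl fun k hk => layer (Z k) (hZφ k hk),
    ← lintegral_finsetSum _ fun k _ => meas (Z k), ← lintegral_const_mul _ (meas Y)]
  refine setLIntegral_mono ((meas Y).const_mul _) fun t ht => ?_
  rcases hφ t ht with h | ⟨b, hb, h⟩
  · have : ∀ k ∈ s, μ {ω | t < φ (Z k ω)} = 0 := fun k _ => by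
      simp [h _ (hZ0 k _)]
    rw [Finset.sum_eq_zero this]
    exact zero_le
  · simpa only [h _ (hZ0 _ _), h _ (hY0 _)] using hdom b hb

lemma min_sq_div_floor_le {y c : ℝ} (hy : 0 ≤ y) (hc : 1 < c) (n : ℕ) :
    min y ⌊c ^ n⌋₊ ^ 2 / ⌊c ^ n⌋₊ ≤
      8 * c / (c - 1) * (c ^ (n + 1) * y / (c ^ (n + 1) + y) - c ^ n * y / (c ^ n + y)) := by
  have h1 : 1 ≤ c ^ n := one_le_pow₀ hc.le
  have hN : (1 : ℝ) ≤ ⌊c ^ n⌋₊ := by exact_mod_cast Nat.le_floor (by simpa using h1)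
  have hN1 : (⌊c ^ n⌋₊ : ℝ) ≤ c ^ n := Nat.floor_le (by positivity)
  have hN2 : c ^ n < ⌊c ^ n⌋₊ + 1 := Nat.lt_floor_add_one _
  rw [pow_succ c n]
  generalize c ^ n = r at *
  generalize (⌊r⌋₊ : ℝ) = N at *
  have hc1 : 0 < c - 1 := by linarith
  have hr : 0 < r := by linarith
  have hN0 : 0 < N := by linarith
  have hry : min y r * (r + y) ≤ 2 * (r * y) := by
    rcases le_total y r with h | h
    · rw [min_eq_left h]; nlinarith
    · rw [min_eq_right h]; nlinarith
  have hm : 0 ≤ min y r := le_min hy hr.le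
  have key : min y r ^ 2 * (r + y) ^ 2 ≤ 4 * (r * y) ^ 2 := by
    nlinarith [mul_nonneg hm (by positivity : 0 ≤ r + y), mul_nonneg hr.le hy]
  have e : 8 * c / (c - 1) * (r * c * y / (r * c + y) - r * y / (r + y)) =
      8 * c * (r * y ^ 2) / ((r * c + y) * (r + y)) := by
    field_simp
    ring
  rw [e]
  calc min y N ^ 2 / N ≤ min y r ^ 2 / (r / 2) := by
        have : 0 ≤ min y N := le_min hy hN0.le
        gcongr
        linarith
    _ = 2 * min y r ^ 2 / r := by field_simp
    _ ≤ 8 * (r * y ^ 2) / ((r + y) * (r + y)) := by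
        rw [div_le_div_iff₀ hr (by positivity)]
        nlinarith
    _ = 8 * c * (r * y ^ 2) / ((r * c + c * y) * (r + y)) := by
        field_simp
    _ ≤ 8 * c * (r * y ^ 2) / ((r * c + y) * (r + y)) := by
        gcongr
        nlinarith

lemma sum_min_sq_div_floor_le {y c : ℝ} (hy : 0 ≤ y) (hc : 1 < c) (K : ℕ) :
    ∑ n ∈ Finset.range K, min y ⌊c ^ n⌋₊ ^ 2 / ⌊c ^ n⌋₊ ≤ 8 * c / (c - 1) * y := by
  have hc1 : 0 < c - 1 := by linarith
  refine (Finset.sum_le_sum fun n _ => min_sq_div_floor_le hy hc n).trans ?_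
  rw [← Finset.mul_sum, Finset.sum_range_sub fun n => c ^ n * y / (c ^ n + y)]
  have hK : 0 < c ^ K := by positivity
  have h1 : c ^ K * y / (c ^ K + y) ≤ y := by
    rw [div_le_iff₀ (by positivity)]
    nlinarith
  have h0 : 0 ≤ c ^ 0 * y / (c ^ 0 + y) := by positivity
  gcongr
  linarith

lemma integrable_min_sq {Ω : Type*} [MeasurableSpace Ω] {μ : Measure Ω} [IsProbabilityMeasure μ]
    {Y : Ω → ℝ} (hY : Measurable Y) (hY0 : ∀ ω, 0 ≤ Y ω) (N : ℝ) (hN : 0 ≤ N) :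
    Integrable (fun ω => min (Y ω) N ^ 2) μ := by
  refine Integrable.of_bound (by fun_prop) (N ^ 2) (ae_of_all _ fun ω => ?_)
  rw [Real.norm_eq_abs, abs_of_nonneg (sq_nonneg _)]
  have : 0 ≤ min (Y ω) N := le_min (hY0 ω) hN
  gcongr
  exact min_le_right _ _

lemma summable_integral_min_sq_div_floor {Ω : Type*} [MeasurableSpace Ω] {μ : Measure Ω}
    [IsProbabilityMeasure μ] {Y : Ω → ℝ} (hY : Measurable Y) (hY0 : ∀ ω, 0 ≤ Y ω)
    (hYint : Integrable Y μ) {c : ℝ} (hc : 1 < c) :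
    Summable fun n : ℕ => (∫ ω, min (Y ω) ⌊c ^ n⌋₊ ^ 2 ∂μ) / ⌊c ^ n⌋₊ := by
  refine summable_of_sum_range_le (c := 8 * c / (c - 1) * ∫ ω, Y ω ∂μ)
    (fun n => div_nonneg (integral_nonneg fun ω => sq_nonneg _) (Nat.cast_nonneg _)) fun K => ?_
  simp_rw [← integral_div]
  rw [← integral_finsetSum _ fun n _ =>
    (integrable_min_sq hY hY0 _ (Nat.cast_nonneg _)).div_const _, ← integral_const_mul]
  refine integral_mono (integrable_finsetSum _ fun n _ =>
    (integrable_min_sq hY hY0 _ (Nat.cast_nonneg _)).div_const _) (hYint.const_mul _) fun ω => ?_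
  exact sum_min_sq_div_floor_le (hY0 ω) hc K

lemma tendsto_integral_max_sub_zero {Ω : Type*} [MeasurableSpace Ω] {μ : Measure Ω}
    {Y : Ω → ℝ} (hY : Measurable Y) (hYint : Integrable Y μ) :
    Tendsto (fun N : ℕ => ∫ ω, max (Y ω - N) 0 ∂μ) atTop (nhds 0) := by
  suffices h : Tendsto (fun N : ℕ => ∫ ω, max (Y ω - N) 0 ∂μ) atTop (nhds (∫ _, (0 : ℝ) ∂μ)) by
    simpa using h
  refine tendsto_integral_of_dominated_convergence (fun ω => |Y ω|) (fun n => by fun_prop)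
    hYint.abs (fun n => ae_of_all _ fun ω => ?_) (ae_of_all _ fun ω => ?_)
  · have hn : (0 : ℝ) ≤ n := Nat.cast_nonneg _
    rw [Real.norm_eq_abs, abs_of_nonneg (le_max_right _ _)]
    exact max_le (by linarith [le_abs_self (Y ω)]) (abs_nonneg _)
  · refine tendsto_const_nhds.congr' ?_
    filter_upwards [tendsto_natCast_atTop_atTop.eventually_ge_atTop (Y ω)] with n hn
    exact (max_eq_right (by linarith)).symm

/-- Two monotone sequences whose difference is `o(n)` along `⌊c ^ j⌋₊` for `c` arbitrarily close
to `1` differ by `o(n)`, if one of them is almost Lipschitz at large scales. -/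
lemma tendsto_sub_div_of_floor_pow {u v : ℕ → ℝ} (hu : Monotone u) (hv : Monotone v)
    (hinc : ∀ ε > 0, ∃ M, 0 ≤ M ∧ ∀ m n : ℕ, m ≤ n → v n - v m ≤ M * (n - m) + ε * n)
    (hlim : ∀ k : ℕ, Tendsto (fun j : ℕ => (u ⌊(1 + 1 / ((k : ℝ) + 1)) ^ j⌋₊ -
      v ⌊(1 + 1 / ((k : ℝ) + 1)) ^ j⌋₊) / ⌊(1 + 1 / ((k : ℝ) + 1)) ^ j⌋₊) atTop (nhds 0)) :
    Tendsto (fun n : ℕ => (u n - v n) / (n : ℝ)) atTop (nhds 0) := by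
  rw [Metric.tendsto_atTop]
  intro ε₀ hε₀
  obtain ⟨ε, hε, rfl⟩ : ∃ ε, 0 < ε ∧ ε₀ = 7 * ε := ⟨ε₀ / 7, by positivity, by ring⟩
  obtain ⟨M, hM, hvM⟩ := hinc ε hε
  obtain ⟨k, hk⟩ := exists_nat_ge (M / ε)
  specialize hlim k
  have hk1 : M * (1 / ((k : ℝ) + 1)) ≤ ε := by
    rw [div_le_iff₀ hε] at hk
    rw [mul_one_div, div_le_iff₀ (by positivity)]
    nlinarith
  have hk2 : 1 / ((k : ℝ) + 1) ≤ 1 := by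
    rw [div_le_one (by positivity)]
    linarith [(Nat.cast_nonneg k : (0 : ℝ) ≤ k)]
  have hk3 : 0 < 1 / ((k : ℝ) + 1) := by positivity
  generalize 1 / ((k : ℝ) + 1) = d at *
  rw [Metric.tendsto_atTop] at hlim
  obtain ⟨J, hJ⟩ := hlim ε hε
  have hc : 1 < 1 + d := by linarith
  have habs : ∀ j, J ≤ j → |u ⌊(1 + d) ^ j⌋₊ - v ⌊(1 + d) ^ j⌋₊| ≤ ε * ⌊(1 + d) ^ j⌋₊ := by
    intro j hj
    have hpos : (0 : ℝ) < ⌊(1 + d) ^ j⌋₊ := by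
      exact_mod_cast Nat.le_floor (by simpa using one_le_pow₀ hc.le)
    have := hJ j hj
    rw [Real.dist_eq, sub_zero, abs_div, Nat.abs_cast, div_lt_iff₀ hpos] at this
    exact this.le
  obtain ⟨P, hP⟩ := exists_nat_ge (max ((1 + d) ^ J) ((4 * ε + 2 * M) / ε))
  refine ⟨P, fun p hp => ?_⟩
  have hpP : (P : ℝ) ≤ p := by exact_mod_cast hp
  have hpJ : (1 + d) ^ J ≤ p := (le_max_left _ _).trans (hP.trans hpP)
  have hpM : 4 * ε + 2 * M ≤ ε * p := by
    have := (le_max_right _ _).trans (hP.trans hpP)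
    rw [div_le_iff₀ hε] at this
    linarith
  have hp1 : (1 : ℝ) ≤ p := (one_le_pow₀ hc.le).trans hpJ
  obtain ⟨j, hj1, hj2⟩ := exists_nat_pow_near hp1 hc
  have hJj : J ≤ j := by
    have := (pow_lt_pow_iff_right₀ hc).1 (hpJ.trans_lt hj2)
    omega
  have a1 := habs j hJj
  have a2 := habs (j + 1) (by omega)
  have hcj : 0 < (1 + d) ^ j := by positivity
  have b1 : ⌊(1 + d) ^ j⌋₊ ≤ p := Nat.floor_le_of_le hj1
  have b2 : p ≤ ⌊(1 + d) ^ (j + 1)⌋₊ := Nat.le_floor hj2.le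
  have b3 : (1 + d) ^ j < ⌊(1 + d) ^ j⌋₊ + 1 := Nat.lt_floor_add_one _
  have b4 : (⌊(1 + d) ^ (j + 1)⌋₊ : ℝ) ≤ (1 + d) ^ j * (1 + d) := by
    rw [← pow_succ]
    exact Nat.floor_le (by positivity)
  have b1' : (⌊(1 + d) ^ j⌋₊ : ℝ) ≤ p := by exact_mod_cast b1
  have hv' := hvM _ _ (b1.trans b2)
  have u1 := hu b1
  have u2 := hu b2
  have v1 := hv b1
  have v2 := hv b2
  generalize ⌊(1 + d) ^ (j + 1)⌋₊ = n at *
  generalize ⌊(1 + d) ^ j⌋₊ = m at *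
  have hm : (0 : ℝ) ≤ m := Nat.cast_nonneg _
  have c1 : (n : ℝ) ≤ m + d * m + 2 := by nlinarith
  have c2 : (n : ℝ) ≤ 2 * p + 2 := by nlinarith
  have c3 : M * ((n : ℝ) - m) ≤ ε * p + 2 * M := by
    calc M * ((n : ℝ) - m) ≤ M * (d * m + 2) := by gcongr; linarith
      _ = M * d * m + 2 * M := by ring
      _ ≤ ε * p + 2 * M := by gcongr
  have c4 : ε * n ≤ 2 * (ε * p) + 2 * ε := by nlinarith
  have c5 : ε * m ≤ ε * p := by gcongr
  have hεp : 0 < ε * p := by positivity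
  rw [abs_le] at a1 a2
  rw [Real.dist_eq, sub_zero, abs_div, Nat.abs_cast, div_lt_iff₀ (by linarith), abs_lt]
  constructor <;> linarith

section Nonneg

variable {Ω : Type*} [MeasurableSpace Ω] {μ : Measure Ω} [IsProbabilityMeasure μ]
  {Z : ℕ → Ω → ℝ} {Y : Ω → ℝ} {C : ℝ}

lemma sum_integral_max_sub_le
    (hZ0 : ∀ k ω, 0 ≤ Z k ω) (hint : ∀ n, 1 ≤ n → Integrable (Z n) μ)
    (hYint : Integrable Y μ) (hY0 : ∀ ω, 0 ≤ Y ω) (hC : 0 < C)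
    (hdom : ∀ (n : ℕ) (x : ℝ), 0 ≤ x → ∑ k ∈ Finset.Icc 1 n, μ {ω | x < Z k ω} ≤
      ENNReal.ofReal (C * n) * μ {ω | x < Y ω}) (n M : ℕ) :
    ∑ k ∈ Finset.Icc 1 n, ∫ ω, max (Z k ω - M) 0 ∂μ ≤ C * n * ∫ ω, max (Y ω - M) 0 ∂μ := by
  have hM : (0 : ℝ) ≤ M := Nat.cast_nonneg _
  refine sum_integral_comp_le_of_sum_tail_le (φ := fun x => max (x - M) 0) (by positivity)
    hZ0 hY0 (hdom n) (fun x => le_max_right _ _) (fun t ht => Or.inr ⟨t + M, by positivity,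
      fun x _ => ?_⟩) (fun k hk => ?_) ?_
  · rw [lt_max_iff, or_iff_left (not_lt.2 ht.le), lt_sub_iff_add_lt]
  · exact ((hint k (Finset.mem_Icc.1 hk).1).sub (integrable_const _)).pos_part
  · exact (hYint.sub (integrable_const _)).pos_part

lemma sum_integral_min_sq_le (hmeas : ∀ n, Measurable (Z n)) (hYmeas : Measurable Y)
    (hZ0 : ∀ k ω, 0 ≤ Z k ω) (hY0 : ∀ ω, 0 ≤ Y ω) (hC : 0 < C)
    (hdom : ∀ (n : ℕ) (x : ℝ), 0 ≤ x → ∑ k ∈ Finset.Icc 1 n, μ {ω | x < Z k ω} ≤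
      ENNReal.ofReal (C * n) * μ {ω | x < Y ω}) (n N : ℕ) :
    ∑ k ∈ Finset.Icc 1 n, ∫ ω, min (Z k ω) N ^ 2 ∂μ ≤ C * n * ∫ ω, min (Y ω) N ^ 2 ∂μ := by
  have hN : (0 : ℝ) ≤ N := Nat.cast_nonneg _
  refine sum_integral_comp_le_of_sum_tail_le (φ := fun x => min x N ^ 2) (by positivity)
    hZ0 hY0 (hdom n) (fun x => sq_nonneg _) (fun t ht => ?_)
    (fun k _ => integrable_min_sq (hmeas k) (hZ0 k) _ hN) (integrable_min_sq hYmeas hY0 _ hN)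
  have hlt : ∀ x : ℝ, 0 ≤ x → (t < min x N ^ 2 ↔ √t < x ∧ √t < N) := fun x hx => by
    rw [← Real.sqrt_lt_sqrt_iff ht.le, Real.sqrt_sq (le_min hx hN), lt_min_iff]
  by_cases h : √t < N
  · exact Or.inr ⟨√t, Real.sqrt_nonneg _, fun x hx => by simp [hlt x hx, h]⟩
  · exact Or.inl fun x hx => by simp [hlt x hx, h]

lemma measure_abs_sum_sub_integral_le (hmeas : ∀ n, Measurable (Z n)) (hYmeas : Measurable Y)
    (hindep : ∀ i j, i ≠ j → IndepFun (Z i) (Z j) μ)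
    (hZ0 : ∀ k ω, 0 ≤ Z k ω) (hint : ∀ n, 1 ≤ n → Integrable (Z n) μ)
    (hYint : Integrable Y μ) (hY0 : ∀ ω, 0 ≤ Y ω) (hC : 0 < C)
    (hdom : ∀ (n : ℕ) (x : ℝ), 0 ≤ x → ∑ k ∈ Finset.Icc 1 n, μ {ω | x < Z k ω} ≤
      ENNReal.ofReal (C * n) * μ {ω | x < Y ω}) {N : ℕ} (hN : 0 < N) {ε : ℝ} (hε : 0 < ε)
    (htail : C * ∫ ω, max (Y ω - N) 0 ∂μ ≤ ε) :
    μ {ω | 2 * ε * N < |∑ k ∈ Finset.Icc 1 N, Z k ω - ∑ k ∈ Finset.Icc 1 N, ∫ ω, Z k ω ∂μ|} ≤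
      ENNReal.ofReal ((C / ε ^ 2 + C) * ((∫ ω, min (Y ω) N ^ 2 ∂μ) / N)) := by
  have hN0 : (0 : ℝ) < N := by exact_mod_cast hN
  set T : ℕ → Ω → ℝ := fun k ω => min (Z k ω) N with hT
  have hTmeas : ∀ k, Measurable (T k) := fun k => (hmeas k).min measurable_const
  have hTLp : ∀ k, MemLp (T k) 2 μ := fun k =>
    MemLp.of_bound (hTmeas k).aestronglyMeasurable N (ae_of_all _ fun ω => by
      rw [Real.norm_eq_abs, abs_of_nonneg (le_min (hZ0 k ω) hN0.le)]
      exact min_le_right _ _)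
  have hTint : ∀ k, Integrable (T k) μ := fun k => (hTLp k).integrable (by norm_num)
  set Q := ∫ ω, min (Y ω) N ^ 2 ∂μ with hQ
  have hQ0 : 0 ≤ Q := integral_nonneg fun ω => sq_nonneg _
  have hVar : Var[∑ k ∈ Finset.Icc 1 N, T k; μ] ≤ C * N * Q := by
    rw [IndepFun.variance_sum (fun k _ => hTLp k) fun i _ j _ hij =>
      (hindep i j hij).comp (measurable_id.min measurable_const)
        (measurable_id.min measurable_const)]
    refine le_trans (Finset.sum_le_sum fun k _ =>
      variance_le_expectation_sq (hTmeas k).aestronglyMeasurable) ?_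
    exact sum_integral_min_sq_le hmeas hYmeas hZ0 hY0 hC hdom N N
  have hCheb := meas_ge_le_variance_div_sq (memLp_finsetSum' (Finset.Icc 1 N) fun k _ => hTLp k)
    (mul_pos hε hN0)
  have hBig : μ (⋃ k ∈ Finset.Icc 1 N, {ω | (N : ℝ) < Z k ω}) ≤ ENNReal.ofReal (C * (Q / N)) := by
    refine (measure_biUnion_finset_le _ _).trans ((hdom N N hN0.le).trans ?_)
    have hMarkov := mul_meas_ge_le_integral_of_nonneg (μ := μ)
      (ae_of_all _ fun ω => sq_nonneg (min (Y ω) N)) (integrable_min_sq hYmeas hY0 _ hN0.le)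
      ((N : ℝ) ^ 2)
    have hsub : μ.real {ω | (N : ℝ) < Y ω} ≤ μ.real {ω | (N : ℝ) ^ 2 ≤ min (Y ω) N ^ 2} :=
      measureReal_mono fun ω (hω : (N : ℝ) < Y ω) => by simp [min_eq_right hω.le]
    rw [← ofReal_measureReal (s := {ω | (N : ℝ) < Y ω}), ← ENNReal.ofReal_mul (by positivity)]
    apply ENNReal.ofReal_le_ofReal
    have : μ.real {ω | (N : ℝ) < Y ω} ≤ Q / N ^ 2 := by
      rw [le_div_iff₀ (by positivity), mul_comm]
      exact (mul_le_mul_of_nonneg_left hsub (by positivity)).trans hMarkov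
    calc C * N * μ.real {ω | (N : ℝ) < Y ω} ≤ C * N * (Q / N ^ 2) := by gcongr
      _ = C * (Q / N) := by field_simp
  have hMean : |∑ k ∈ Finset.Icc 1 N, ∫ ω, T k ω ∂μ - ∑ k ∈ Finset.Icc 1 N, ∫ ω, Z k ω ∂μ| ≤
      ε * N := by
    have hdiff : ∑ k ∈ Finset.Icc 1 N, ∫ ω, Z k ω ∂μ - ∑ k ∈ Finset.Icc 1 N, ∫ ω, T k ω ∂μ =
        ∑ k ∈ Finset.Icc 1 N, ∫ ω, max (Z k ω - N) 0 ∂μ := by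
      rw [← Finset.sum_sub_distrib]
      refine Finset.sum_congr rfl fun k hk => ?_
      rw [← integral_sub (hint k (Finset.mem_Icc.1 hk).1) (hTint k)]
      refine integral_congr_ae (ae_of_all _ fun ω => ?_)
      rcases le_total (Z k ω) N with h | h <;> simp [hT, h]
    rw [abs_sub_comm, hdiff, abs_of_nonneg (Finset.sum_nonneg fun k _ =>
      integral_nonneg fun ω => le_max_right _ _)]
    refine (sum_integral_max_sub_le hZ0 hint hYint hY0 hC hdom N N).trans ?_
    nlinarith
  have hsub : {ω | 2 * ε * N <
        |∑ k ∈ Finset.Icc 1 N, Z k ω - ∑ k ∈ Finset.Icc 1 N, ∫ ω, Z k ω ∂μ|} ⊆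
      {ω | ε * N ≤ |(∑ k ∈ Finset.Icc 1 N, T k) ω - ∫ x, (∑ k ∈ Finset.Icc 1 N, T k) x ∂μ|} ∪
        ⋃ k ∈ Finset.Icc 1 N, {ω | (N : ℝ) < Z k ω} := by
    intro ω hω
    by_contra hcon
    simp only [Set.mem_union, Set.mem_iUnion, Set.mem_ofPred_eq, not_or, not_exists, not_lt,
      not_le, Finset.sum_apply] at hcon hω
    rw [integral_finsetSum _ fun k _ => hTint k, Finset.sum_congr rfl
      fun k hk => (min_eq_left (hcon.2 k hk) : T k ω = Z k ω)] at hcon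
    have := abs_sub_le (∑ k ∈ Finset.Icc 1 N, Z k ω) (∑ k ∈ Finset.Icc 1 N, ∫ ω, T k ω ∂μ)
      (∑ k ∈ Finset.Icc 1 N, ∫ ω, Z k ω ∂μ)
    linarith [hcon.1]
  refine (measure_mono hsub).trans ((measure_union_le _ _).trans ?_)
  refine (add_le_add (hCheb.trans (ENNReal.ofReal_le_ofReal ?_)) hBig).trans
    (ENNReal.ofReal_add (p := C / ε ^ 2 * (Q / N)) (by positivity) (by positivity)).ge |>.trans
    (by rw [add_mul])
  calc Var[∑ k ∈ Finset.Icc 1 N, T k; μ] / (ε * N) ^ 2 ≤ C * N * Q / (ε * N) ^ 2 := by gcongr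
    _ = C / ε ^ 2 * (Q / N) := by field_simp

lemma ae_tendsto_sum_sub_integral_div_floor_pow (hmeas : ∀ n, Measurable (Z n))
    (hYmeas : Measurable Y) (hindep : ∀ i j, i ≠ j → IndepFun (Z i) (Z j) μ)
    (hZ0 : ∀ k ω, 0 ≤ Z k ω) (hint : ∀ n, 1 ≤ n → Integrable (Z n) μ)
    (hYint : Integrable Y μ) (hY0 : ∀ ω, 0 ≤ Y ω) (hC : 0 < C)
    (hdom : ∀ (n : ℕ) (x : ℝ), 0 ≤ x → ∑ k ∈ Finset.Icc 1 n, μ {ω | x < Z k ω} ≤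
      ENNReal.ofReal (C * n) * μ {ω | x < Y ω}) {c : ℝ} (hc : 1 < c) :
    ∀ᵐ ω ∂μ, Tendsto (fun j : ℕ => (∑ k ∈ Finset.Icc 1 ⌊c ^ j⌋₊, Z k ω -
      ∑ k ∈ Finset.Icc 1 ⌊c ^ j⌋₊, ∫ ω, Z k ω ∂μ) / ⌊c ^ j⌋₊) atTop (nhds 0) := by
  have hpos : ∀ j : ℕ, 0 < ⌊c ^ j⌋₊ := fun j =>
    Nat.le_floor (by simpa using one_le_pow₀ hc.le)
  have hfl : Tendsto (fun j : ℕ => ⌊c ^ j⌋₊) atTop atTop :=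
    tendsto_nat_floor_atTop.comp (tendsto_pow_atTop_atTop_of_one_lt hc)
  have hev : ∀ i : ℕ, ∀ᵐ ω ∂μ, ∀ᶠ j : ℕ in atTop,
      |∑ k ∈ Finset.Icc 1 ⌊c ^ j⌋₊, Z k ω - ∑ k ∈ Finset.Icc 1 ⌊c ^ j⌋₊, ∫ ω, Z k ω ∂μ| ≤
        2 * (1 / ((i : ℝ) + 1)) * ⌊c ^ j⌋₊ := by
    intro i
    have hε : 0 < 1 / ((i : ℝ) + 1) := by positivity
    generalize 1 / ((i : ℝ) + 1) = ε at *
    have htail : ∀ᶠ j : ℕ in atTop, C * ∫ ω, max (Y ω - ⌊c ^ j⌋₊) 0 ∂μ ≤ ε := by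
      have := ((tendsto_integral_max_sub_zero hYmeas hYint).comp hfl).const_mul C
      rw [mul_zero] at this
      exact (this.eventually_lt_const hε).mono fun j hj => hj.le
    obtain ⟨J, hJ⟩ := eventually_atTop.1 htail
    have hsum := ((summable_nat_add_iff J).2
      ((summable_integral_min_sq_div_floor hYmeas hY0 hYint hc).mul_left
        (C / ε ^ 2 + C))).tsum_ofReal_ne_top
    have hBC := ae_eventually_notMem (ne_top_of_le_ne_top hsum (ENNReal.tsum_le_tsum fun j =>
      measure_abs_sum_sub_integral_le hmeas hYmeas hindep hZ0 hint hYint hY0 hC hdom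
        (hpos (j + J)) hε (hJ (j + J) (by omega))))
    filter_upwards [hBC] with ω hω
    obtain ⟨K, hK⟩ := eventually_atTop.1 hω
    refine eventually_atTop.2 ⟨K + J, fun j hj => ?_⟩
    have := hK (j - J) (by omega)
    rw [Nat.sub_add_cancel (by omega)] at this
    exact not_lt.1 this
  filter_upwards [ae_all_iff.2 hev] with ω hω
  rw [Metric.tendsto_nhds]
  intro δ hδ
  obtain ⟨i, hi⟩ := exists_nat_one_div_lt (half_pos hδ)
  filter_upwards [hω i] with j hj
  have hj0 : (0 : ℝ) < ⌊c ^ j⌋₊ := by exact_mod_cast hpos j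
  rw [Real.dist_eq, sub_zero, abs_div, Nat.abs_cast, div_lt_iff₀ hj0]
  refine hj.trans_lt ?_
  gcongr
  linarith

/-- The strong law of large numbers for nonnegative pairwise independent random variables whose
averaged tails are dominated by the tail of an integrable random variable. -/
lemma ae_tendsto_sum_sub_integral_div_of_nonneg (hmeas : ∀ n, Measurable (Z n))
    (hYmeas : Measurable Y) (hindep : ∀ i j, i ≠ j → IndepFun (Z i) (Z j) μ)
    (hZ0 : ∀ k ω, 0 ≤ Z k ω) (hint : ∀ n, 1 ≤ n → Integrable (Z n) μ)
    (hYint : Integrable Y μ) (hY0 : ∀ ω, 0 ≤ Y ω) (hC : 0 < C)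
    (hdom : ∀ (n : ℕ) (x : ℝ), 0 ≤ x → ∑ k ∈ Finset.Icc 1 n, μ {ω | x < Z k ω} ≤
      ENNReal.ofReal (C * n) * μ {ω | x < Y ω}) :
    ∀ᵐ ω ∂μ, Tendsto (fun n : ℕ => (∑ k ∈ Finset.Icc 1 n, Z k ω -
      ∑ k ∈ Finset.Icc 1 n, ∫ ω, Z k ω ∂μ) / (n : ℝ)) atTop (nhds 0) := by
  have hall := ae_all_iff.2 fun i : ℕ => ae_tendsto_sum_sub_integral_div_floor_pow hmeas hYmeas
    hindep hZ0 hint hYint hY0 hC hdom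
    (show (1 : ℝ) < 1 + 1 / ((i : ℝ) + 1) from lt_add_of_pos_right _ (by positivity))
  filter_upwards [hall] with ω hω
  refine tendsto_sub_div_of_floor_pow (u := fun n => ∑ k ∈ Finset.Icc 1 n, Z k ω)
    (v := fun n => ∑ k ∈ Finset.Icc 1 n, ∫ ω, Z k ω ∂μ) ?_ ?_ ?_ hω
  · exact fun m n hmn => Finset.sum_le_sum_of_subset_of_nonneg
      (Finset.Icc_subset_Icc_right hmn) fun k _ _ => hZ0 k ω
  · exact fun m n hmn => Finset.sum_le_sum_of_subset_of_nonneg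
      (Finset.Icc_subset_Icc_right hmn) fun k _ _ => integral_nonneg (hZ0 k)
  · intro ε hε
    have hlim := (tendsto_integral_max_sub_zero hYmeas hYint).const_mul C
    rw [mul_zero] at hlim
    obtain ⟨M, hM⟩ := (hlim.eventually_lt_const hε).exists
    refine ⟨M, Nat.cast_nonneg _, fun m n hmn => ?_⟩
    have hsub : Finset.Icc 1 m ⊆ Finset.Icc 1 n := Finset.Icc_subset_Icc_right hmn
    rw [← Finset.sum_sdiff hsub, add_sub_cancel_right]
    have hpt : ∀ k ∈ Finset.Icc 1 n, ∫ ω, Z k ω ∂μ ≤ M + ∫ ω, max (Z k ω - M) 0 ∂μ := by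
      intro k hk
      have hk1 := hint k (Finset.mem_Icc.1 hk).1
      have hp : Integrable (fun ω => max (Z k ω - M) 0) μ :=
        (hk1.sub (integrable_const _)).pos_part
      calc ∫ ω, Z k ω ∂μ ≤ ∫ ω, ((M : ℝ) + max (Z k ω - M) 0) ∂μ :=
            integral_mono hk1 ((integrable_const _).add hp) fun ω => by
              linarith [le_max_left (Z k ω - M) 0]
        _ = M + ∫ ω, max (Z k ω - M) 0 ∂μ := by
            rw [integral_add (integrable_const _) hp]; simp
    calc ∑ k ∈ Finset.Icc 1 n \ Finset.Icc 1 m, ∫ ω, Z k ω ∂μ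
        ≤ ∑ k ∈ Finset.Icc 1 n \ Finset.Icc 1 m, (M + ∫ ω, max (Z k ω - M) 0 ∂μ) :=
          Finset.sum_le_sum fun k hk => hpt k (Finset.mem_sdiff.1 hk).1
      _ = M * (n - m) +
          ∑ k ∈ Finset.Icc 1 n \ Finset.Icc 1 m, ∫ ω, max (Z k ω - M) 0 ∂μ := by
          rw [Finset.sum_add_distrib, Finset.sum_const, Finset.card_sdiff_of_subset hsub,
            Nat.card_Icc, Nat.card_Icc, nsmul_eq_mul, add_tsub_cancel_right,
            add_tsub_cancel_right, Nat.cast_sub hmn, mul_comm]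
      _ ≤ M * (n - m) + ∑ k ∈ Finset.Icc 1 n, ∫ ω, max (Z k ω - M) 0 ∂μ := by
          have := Finset.sum_le_sum_of_subset_of_nonneg
            (f := fun k => ∫ ω, max (Z k ω - M) 0 ∂μ)
            (Finset.sdiff_subset : Finset.Icc 1 n \ Finset.Icc 1 m ⊆ _)
            fun k _ _ => integral_nonneg fun ω => le_max_right _ _
          linarith
      _ ≤ M * (n - m) + ε * n := by
          gcongr
          refine (sum_integral_max_sub_le hZ0 hint hYint hY0 hC hdom n M).trans ?_
          rw [mul_right_comm]
          gcongr

end Nonneg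

/-- Corollary 1: pairwise independent integrable random variables with
`sup_{n≥1} (1/n) ∑_{k=1}^n P(|X_k| > x) ≤ C P(|X| > x)` for an integrable random variable `X`
(no uniform bound on `E|X_n|` assumed) satisfy `(S_n - E S_n)/n → 0` a.s. -/
theorem slln_dominated_by_rv {Ω : Type*} [MeasurableSpace Ω] (μ : Measure Ω)
    [IsProbabilityMeasure μ]
    (X : ℕ → Ω → ℝ) (hmeas : ∀ n, Measurable (X n))
    (hindep : ∀ i j, i ≠ j → IndepFun (X i) (X j) μ)
    (hint : ∀ n, 1 ≤ n → Integrable (X n) μ)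
    (Y : Ω → ℝ) (hYmeas : Measurable Y)
    (hYint : (∫⁻ ω, ENNReal.ofReal |Y ω| ∂μ) < ⊤)
    (C : ℝ) (hC : 0 < C)
    (hdom : ∀ x : ℝ, 0 ≤ x →
      (⨆ n, ⨆ (_ : 1 ≤ n), (∑ k ∈ Finset.Icc 1 n, μ {ω | x < |X k ω|}) / (n : ℝ≥0∞))
        ≤ ENNReal.ofReal C * μ {ω | x < |Y ω|}) :
    ∀ᵐ ω ∂μ, Tendsto
      (fun n : ℕ => ((∑ k ∈ Finset.Icc 1 n, X k ω)
        - ∫ ω', ∑ k ∈ Finset.Icc 1 n, X k ω' ∂μ) / (n : ℝ))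
      atTop (nhds 0) := by
  have hY : Integrable (fun ω => |Y ω|) μ := by
    refine ⟨hYmeas.abs.aestronglyMeasurable, ?_⟩
    rw [hasFiniteIntegral_iff_ofReal (ae_of_all _ fun ω => abs_nonneg _)]
    exact hYint
  have hsum : ∀ (n : ℕ) (x : ℝ), 0 ≤ x → ∑ k ∈ Finset.Icc 1 n, μ {ω | x < |X k ω|} ≤
      ENNReal.ofReal (C * n) * μ {ω | x < |Y ω|} := by
    intro n x hx
    rcases Nat.eq_zero_or_pos n with rfl | hn
    · simp
    have := (le_iSup₂ (f := fun (n : ℕ) (_ : 1 ≤ n) =>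
      (∑ k ∈ Finset.Icc 1 n, μ {ω | x < |X k ω|}) / (n : ℝ≥0∞)) n hn).trans (hdom x hx)
    rw [ENNReal.div_le_iff (by simpa using hn.ne') (ENNReal.natCast_ne_top n)] at this
    rwa [ENNReal.ofReal_mul hC.le, ENNReal.ofReal_natCast, mul_right_comm]
  have hpart : ∀ p : ℝ → ℝ, Measurable p → (∀ x, 0 ≤ p x) → (∀ x, p x ≤ |x|) →
      ∀ᵐ ω ∂μ, Tendsto (fun n : ℕ => (∑ k ∈ Finset.Icc 1 n, p (X k ω) -
        ∑ k ∈ Finset.Icc 1 n, ∫ ω, p (X k ω) ∂μ) / (n : ℝ)) atTop (nhds 0) := by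
    intro p hp hp0 hple
    refine ae_tendsto_sum_sub_integral_div_of_nonneg (Z := fun k ω => p (X k ω))
      (fun n => hp.comp (hmeas n)) hYmeas.abs (fun i j hij => (hindep i j hij).comp hp hp)
      (fun k ω => hp0 _) (fun n hn => ?_) hY (fun ω => abs_nonneg _) hC fun n x hx => ?_
    · refine (hint n hn).mono (hp.comp (hmeas n)).aestronglyMeasurable (ae_of_all _ fun ω => ?_)
      rw [Real.norm_eq_abs, abs_of_nonneg (hp0 _)]
      exact hple _
    · exact (Finset.sum_le_sum fun k _ => measure_mono fun ω (hω : x < p (X k ω)) =>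
        hω.trans_le (hple _)).trans (hsum n x hx)
  have hpos := hpart (fun x => max x 0) (measurable_id.max measurable_const)
    (fun x => le_max_right _ _) fun x => max_le (le_abs_self x) (abs_nonneg x)
  have hneg := hpart (fun x => max (-x) 0) (measurable_neg.max measurable_const)
    (fun x => le_max_right _ _) fun x => max_le (neg_le_abs x) (abs_nonneg x)
  filter_upwards [hpos, hneg] with ω h₁ h₂
  have h := h₁.sub h₂
  rw [sub_zero] at h
  refine h.congr fun n => ?_
  have hmean : ∫ ω', ∑ k ∈ Finset.Icc 1 n, X k ω' ∂μ =
      ∑ k ∈ Finset.Icc 1 n, ∫ ω', max (X k ω') 0 ∂μ -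
        ∑ k ∈ Finset.Icc 1 n, ∫ ω', max (-X k ω') 0 ∂μ := by
    rw [integral_finsetSum _ fun k hk => hint k (Finset.mem_Icc.1 hk).1, ← Finset.sum_sub_distrib]
    refine Finset.sum_congr rfl fun k hk => ?_
    have hk1 := hint k (Finset.mem_Icc.1 hk).1
    rw [← integral_sub hk1.pos_part hk1.neg_part]
    simp only [max_zero_sub_max_neg_zero_eq_self]
  have hpt : ∑ k ∈ Finset.Icc 1 n, X k ω =
      ∑ k ∈ Finset.Icc 1 n, max (X k ω) 0 - ∑ k ∈ Finset.Icc 1 n, max (-X k ω) 0 := by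
    simp only [← Finset.sum_sub_distrib, max_zero_sub_max_neg_zero_eq_self]
  rw [hmean, hpt, ← sub_div]
  ring
end

section
/- Let (X_n)_{n≥1} be a sequence of non-negative integrable random variables and let (a_n)_{n≥1} be a non-decreasing unbounded sequence of positive real numbers. Set G(x) = sup_{n≥1} (1/a_n) ∑_{k=1}^{n} P(X_k > x) for x ≥ 0, and suppose ∫_0^∞ G(x) dx < ∞ and ∑_{n=1}^∞ P(X_n > a_n) < ∞. Let Y_n = X_n · 1_{{X_n ≤ a_n}} and T_n = ∑_{k=1}^{n} Y_k. Then (E S_n − E T_n)/a_n → 0 as n → ∞, where S_n = ∑_{k=1}^{n} X_k. -/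
open MeasureTheory ProbabilityTheory Filter ENNReal

/-- The tail function `x ↦ μ {x < f}` is measurable. -/
lemma measurable_measure_lt {Ω : Type*} [MeasurableSpace Ω] (μ : Measure Ω) (f : Ω → ℝ) :
    Measurable fun x : ℝ => μ {ω | x < f ω} :=
  Antitone.measurable fun _ _ hxy => measure_mono fun _ hω => lt_of_le_of_lt hxy hω

/-- Normalised partial sums of a summable sequence tend to zero when the normalisation diverges. -/
lemma tendsto_sum_Icc_div_ofReal {p : ℕ → ℝ≥0∞} (hp : (∑' n, p (n + 1)) < ⊤) {a : ℕ → ℝ}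
    (ha : Tendsto a atTop atTop) :
    Tendsto (fun n => (∑ k ∈ Finset.Icc 1 n, p k) / ENNReal.ofReal (a n)) atTop (nhds 0) := by
  have hlim : Tendsto (fun n => (∑' n, p (n + 1)) / ENNReal.ofReal (a n)) atTop (nhds 0) := by
    simpa [Function.comp_def] using ENNReal.Tendsto.const_div
      (ENNReal.tendsto_ofReal_atTop.comp ha) (Or.inr hp.ne)
  refine tendsto_of_tendsto_of_tendsto_of_le_of_le tendsto_const_nhds hlim
    (fun _ => zero_le) fun n => ENNReal.div_le_div_right ?_ _
  rw [← Finset.Ico_add_one_right_eq_Icc, Finset.sum_Ico_eq_sum_range]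
  simp_rw [add_comm 1]
  exact ENNReal.sum_le_tsum _

/-- Step (3.6) of the proof of Theorem 1: for non-negative integrable random variables with
`∫_0^∞ G < ∞` and `∑ P(X_n > a_n) < ∞`, where `G x = sup_{n≥1} (1/a_n) ∑_{k=1}^n P(X_k > x)`
and `Y_n = X_n · 1_{X_n ≤ a_n}`, `T_n = ∑_{k=1}^n Y_k`, we have `(E S_n - E T_n)/a_n → 0`. -/
theorem truncation_expectation_negligible {Ω : Type*} [MeasurableSpace Ω] (μ : Measure Ω)
    [IsProbabilityMeasure μ]
    (X : ℕ → Ω → ℝ) (hmeas : ∀ n, Measurable (X n))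
    (hnonneg : ∀ n ω, 0 ≤ X n ω)
    (hint : ∀ n, 1 ≤ n → Integrable (X n) μ)
    (a : ℕ → ℝ) (ha_pos : ∀ n, 0 < a n) (ha_mono : Monotone a)
    (ha_unbdd : Tendsto a atTop atTop)
    (hG : (∫⁻ x in Set.Ioi (0 : ℝ), ⨆ n, ⨆ (_ : 1 ≤ n),
        (∑ k ∈ Finset.Icc 1 n, μ {ω | x < X k ω}) / ENNReal.ofReal (a n)) < ⊤)
    (hsum : (∑' n : ℕ, μ {ω | a (n + 1) < X (n + 1) ω}) < ⊤) :
    Tendsto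
      (fun n : ℕ => ((∫ ω, ∑ k ∈ Finset.Icc 1 n, X k ω ∂μ)
        - ∫ ω, ∑ k ∈ Finset.Icc 1 n, ({ω' | X k ω' ≤ a k}.indicator (X k)) ω ∂μ) / a n)
      atTop (nhds 0) := by
  set Z : ℕ → Ω → ℝ := fun k => {ω | a k < X k ω}.indicator (X k) with hZ
  have hZ_meas (k) : Measurable (Z k) :=
    (hmeas k).indicator (measurableSet_lt measurable_const (hmeas k))
  have hZ_nonneg (k ω) : 0 ≤ Z k ω := Set.indicator_nonneg (fun ω _ => hnonneg k ω) ω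
  have hZ_int (k) (hk : 1 ≤ k) : Integrable (Z k) μ :=
    (hint k hk).indicator (measurableSet_lt measurable_const (hmeas k))
  have hZ_le (k ω) : Z k ω ≤ X k ω := Set.indicator_le_self' (fun ω _ => hnonneg k ω) ω
  have hdiff (n : ℕ) : (∫ ω, ∑ k ∈ Finset.Icc 1 n, X k ω ∂μ)
      - ∫ ω, ∑ k ∈ Finset.Icc 1 n, ({ω' | X k ω' ≤ a k}.indicator (X k)) ω ∂μ
      = ∫ ω, ∑ k ∈ Finset.Icc 1 n, Z k ω ∂μ := by
    rw [← integral_sub]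
    · refine integral_congr_ae (Eventually.of_forall fun ω => ?_)
      simp only [← Finset.sum_sub_distrib]
      refine Finset.sum_congr rfl fun k _ => ?_
      by_cases h : X k ω ≤ a k
      · simp [hZ, Set.indicator, h, not_lt.mpr h]
      · simp [hZ, Set.indicator, h, not_le.mp h]
    · exact integrable_finsetSum _ fun k hk => hint k (Finset.mem_Icc.mp hk).1
    · exact integrable_finsetSum _ fun k hk => (hint k (Finset.mem_Icc.mp hk).1).indicator
        (measurableSet_le (hmeas k) measurable_const)
  have hrepr (n : ℕ) : (∫ ω, ∑ k ∈ Finset.Icc 1 n, Z k ω ∂μ) / a n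
      = (∫⁻ x in Set.Ioi (0 : ℝ),
          (∑ k ∈ Finset.Icc 1 n, μ {ω | x < Z k ω}) / ENNReal.ofReal (a n)).toReal := by
    simp_rw [div_eq_mul_inv]
    rw [lintegral_mul_const _ (Finset.measurable_fun_sum _ fun k _ => measurable_measure_lt μ _),
      lintegral_finsetSum _ fun k _ => measurable_measure_lt μ _, ENNReal.toReal_mul,
      ENNReal.toReal_inv, ENNReal.toReal_ofReal (ha_pos n).le]
    congr 1
    rw [integral_eq_lintegral_of_nonneg_ae
      (Eventually.of_forall fun ω => Finset.sum_nonneg fun k _ => hZ_nonneg k ω)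
      (Finset.measurable_fun_sum _ fun k _ => hZ_meas k).aestronglyMeasurable]
    simp_rw [ENNReal.ofReal_sum_of_nonneg fun k _ => hZ_nonneg k _]
    rw [lintegral_finsetSum _ fun k _ => (hZ_meas k).ennreal_ofReal]
    congr 1
    exact Finset.sum_congr rfl fun k _ => lintegral_eq_lintegral_meas_lt μ
      (Eventually.of_forall (hZ_nonneg k)) (hZ_meas k).aemeasurable
  simp_rw [hdiff, hrepr]
  have hlim := tendsto_lintegral_of_dominated_convergence
    (μ := volume.restrict (Set.Ioi (0 : ℝ))) (f := fun _ => 0)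
    (F := fun n x => (∑ k ∈ Finset.Icc 1 n, μ {ω | x < Z k ω}) / ENNReal.ofReal (a n)) _
    (fun n => (Finset.measurable_fun_sum _ fun k _ => measurable_measure_lt μ _).div_const _)
    (fun n => Eventually.of_forall fun x => ?_) hG.ne ?_
  · simpa [Function.comp_def] using (ENNReal.tendsto_toReal (by simp)).comp hlim
  · rcases Nat.eq_zero_or_pos n with rfl | hn
    · simp
    · refine le_trans ?_ (le_iSup₂ n hn)
      exact ENNReal.div_le_div_right (Finset.sum_le_sum fun k _ =>
        measure_mono fun ω hω => lt_of_lt_of_le hω (hZ_le k ω)) _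
  · refine (ae_restrict_iff' measurableSet_Ioi).mpr (Eventually.of_forall fun x hx => ?_)
    refine tendsto_of_tendsto_of_tendsto_of_le_of_le tendsto_const_nhds
      (tendsto_sum_Icc_div_ofReal (p := fun k => μ {ω | a k < X k ω}) hsum ha_unbdd)
      (fun _ => zero_le) fun n => ENNReal.div_le_div_right
        (Finset.sum_le_sum fun k _ => measure_mono fun ω hω => ?_) _
    have hpos : 0 < Z k ω := lt_trans hx hω
    exact Set.mem_of_indicator_ne_zero hpos.ne'
end

section
/- Let (X_n)_{n≥1} be a sequence of non-negative random variables and let (a_n)_{n≥1} be a non-decreasing unbounded sequence of positive real numbers. Set G(x) = sup_{n≥1} (1/a_n) ∑_{k=1}^{n} P(X_k > x) for x ≥ 0 and suppose ∫_0^∞ G(x) dx < ∞. Let Y_n = X_n · 1_{{X_n ≤ a_n}}. Then ∑_{n=1}^∞ Var(Y_n)/a_n² ≤ 16 ∫_0^∞ G(y) dy < ∞. -/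
open MeasureTheory ProbabilityTheory Filter ENNReal

lemma lintegral_Ioi_ofReal_rpow {c s : ℝ} (hc : 0 < c) (hs : s < -1) :
    ∫⁻ t in Set.Ioi c, ENNReal.ofReal (t ^ s) = ENNReal.ofReal (-c ^ (s + 1) / (s + 1)) := by
  rw [← integral_Ioi_rpow_of_lt hs hc,
    ofReal_integral_eq_lintegral_ofReal (integrableOn_Ioi_rpow_of_lt hs hc)]
  filter_upwards [ae_restrict_mem measurableSet_Ioi] with t ht
  exact Real.rpow_nonneg (hc.trans ht).le s

lemma tsum_ite_le_mul_of_sum_Icc_le {p : ℕ → ℝ≥0∞} {a : ℕ → ℝ}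
    {G : ℝ≥0∞} (hS : ∀ n, 1 ≤ n → ∑ k ∈ Finset.Icc 1 n, p k ≤ G * ENNReal.ofReal (a n)) (t : ℝ) :
    ∑' n, (if a (n + 1) < t then p (n + 1) else 0) ≤ G * ENNReal.ofReal t := by
  refine ENNReal.tsum_le_of_sum_range_le fun M => ?_
  induction M with
  | zero => simp
  | succ M ih =>
    by_cases h : a (M + 1) < t
    · calc ∑ n ∈ Finset.range (M + 1), (if a (n + 1) < t then p (n + 1) else 0)
          ≤ ∑ n ∈ Finset.range (M + 1), p (n + 1) :=
            Finset.sum_le_sum fun n _ => by split_ifs <;> simp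
        _ = ∑ k ∈ Finset.Icc 1 (M + 1), p k := by
            rw [Finset.range_eq_Ico, Finset.sum_Ico_add' p 0 (M + 1) 1]
            rfl
        _ ≤ G * ENNReal.ofReal (a (M + 1)) := hS _ (by lia)
        _ ≤ G * ENNReal.ofReal t := by gcongr
    · rw [Finset.sum_range_succ, if_neg h, add_zero]
      exact ih

lemma tsum_ite_div_sq_mul_le {p : ℕ → ℝ≥0∞} {a : ℕ → ℝ} (ha_pos : ∀ n, 0 < a n)
    {G : ℝ≥0∞}
    (hS : ∀ n, 1 ≤ n → ∑ k ∈ Finset.Icc 1 n, p k ≤ G * ENNReal.ofReal (a n))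
    {x : ℝ} (hx : 0 < x) :
    (∑' n, (if x < a (n + 1) then p (n + 1) / ENNReal.ofReal (a (n + 1) ^ 2) else 0))
      * ENNReal.ofReal x ≤ 2 * G := by
  have hterm : ∀ n, (if x < a (n + 1) then p (n + 1) / ENNReal.ofReal (a (n + 1) ^ 2) else 0)
      ≤ ∫⁻ t in Set.Ioi x, 2 * ENNReal.ofReal (t ^ (-3 : ℝ)) *
        (if a (n + 1) < t then p (n + 1) else 0) := by
    intro n
    split_ifs with h
    · have hpos := ha_pos (n + 1)
      have key : p (n + 1) / ENNReal.ofReal (a (n + 1) ^ 2)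
          = ∫⁻ t in Set.Ioi (a (n + 1)), 2 * ENNReal.ofReal (t ^ (-3 : ℝ)) * p (n + 1) := by
        rw [lintegral_mul_const _ (by fun_prop), lintegral_const_mul _ (by fun_prop),
          lintegral_Ioi_ofReal_rpow hpos (by norm_num), div_eq_mul_inv, mul_comm,
          ← ENNReal.ofReal_inv_of_pos (by positivity)]
        congr 1
        rw [show (2 : ℝ≥0∞) = ENNReal.ofReal 2 by simp, ← ENNReal.ofReal_mul (by norm_num)]
        congr 1
        rw [show (-3 + 1 : ℝ) = -(2 : ℕ) by norm_num, Real.rpow_neg hpos.le, Real.rpow_natCast]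
        push_cast
        ring
      rw [key]
      calc ∫⁻ t in Set.Ioi (a (n + 1)), 2 * ENNReal.ofReal (t ^ (-3 : ℝ)) * p (n + 1)
          = ∫⁻ t in Set.Ioi (a (n + 1)), 2 * ENNReal.ofReal (t ^ (-3 : ℝ)) *
              (if a (n + 1) < t then p (n + 1) else 0) :=
            setLIntegral_congr_fun measurableSet_Ioi fun t ht => by
              simp only [Set.mem_Ioi] at ht
              simp only [if_pos ht]
        _ ≤ _ := lintegral_mono_set (Set.Ioi_subset_Ioi h.le)
    · exact zero_le
  have hmeas : ∀ n, Measurable fun t : ℝ => 2 * ENNReal.ofReal (t ^ (-3 : ℝ)) *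
      (if a (n + 1) < t then p (n + 1) else 0) := fun n =>
    Measurable.mul (by fun_prop) (Measurable.ite measurableSet_Ioi measurable_const measurable_const)
  calc _ ≤ (∑' n, ∫⁻ t in Set.Ioi x, 2 * ENNReal.ofReal (t ^ (-3 : ℝ)) *
        (if a (n + 1) < t then p (n + 1) else 0)) * ENNReal.ofReal x := by
        gcongr with n
        exact hterm n
    _ = (∫⁻ t in Set.Ioi x, 2 * ENNReal.ofReal (t ^ (-3 : ℝ)) *
        ∑' n, (if a (n + 1) < t then p (n + 1) else 0)) * ENNReal.ofReal x := by
        rw [← lintegral_tsum fun n => (hmeas n).aemeasurable]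
        simp_rw [ENNReal.tsum_mul_left]
    _ ≤ (∫⁻ t in Set.Ioi x, 2 * G * ENNReal.ofReal (t ^ (-2 : ℝ))) * ENNReal.ofReal x := by
        gcongr ?_ * _
        refine setLIntegral_mono' measurableSet_Ioi fun t ht => ?_
        have ht0 : 0 < t := hx.trans ht
        calc _ ≤ 2 * ENNReal.ofReal (t ^ (-3 : ℝ)) * (G * ENNReal.ofReal t) := by
              gcongr
              exact tsum_ite_le_mul_of_sum_Icc_le hS t
          _ = 2 * G * (ENNReal.ofReal (t ^ (-3 : ℝ)) * ENNReal.ofReal t) := by ring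
          _ = _ := by
              rw [← ENNReal.ofReal_mul (by positivity), ← Real.rpow_add_one ht0.ne']
              norm_num
    _ = 2 * G := by
        rw [lintegral_const_mul _ (by fun_prop), lintegral_Ioi_ofReal_rpow hx (by norm_num),
          mul_assoc, ← ENNReal.ofReal_mul' hx.le]
        rw [show (-2 + 1 : ℝ) = -1 by norm_num, Real.rpow_neg_one, neg_div_neg_eq, div_one,
          inv_mul_cancel₀ hx.ne', ENNReal.ofReal_one, mul_one]

lemma evariance_indicator_le_le {Ω : Type*} [MeasurableSpace Ω] (μ : Measure Ω)
    [IsProbabilityMeasure μ] {X : Ω → ℝ} (hX : Measurable X) (hX0 : ∀ ω, 0 ≤ X ω) (c : ℝ) :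
    evariance ({ω | X ω ≤ c}.indicator X) μ
      ≤ 2 * ∫⁻ t in Set.Ioi (0 : ℝ), if t < c then μ {ω | t < X ω} * ENNReal.ofReal t else 0 := by
  set Y := {ω | X ω ≤ c}.indicator X with hY
  have hYm : Measurable Y := hX.indicator (hX measurableSet_Iic)
  have hY0 : ∀ ω, 0 ≤ Y ω := Set.indicator_nonneg fun ω _ => hX0 ω
  calc evariance Y μ ≤ ∫⁻ ω, ‖Y ω‖ₑ ^ 2 ∂μ := by
        rw [evariance_def' hYm.aestronglyMeasurable]
        exact tsub_le_self
    _ = ∫⁻ ω, ENNReal.ofReal (Y ω ^ (2 : ℝ)) ∂μ := by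
        refine lintegral_congr fun ω => ?_
        rw [Real.enorm_of_nonneg (hY0 ω), ← ENNReal.ofReal_pow (hY0 ω), Real.rpow_two]
    _ = 2 * ∫⁻ t in Set.Ioi (0 : ℝ), μ {ω | t < Y ω} * ENNReal.ofReal (t ^ ((2 : ℝ) - 1)) := by
        rw [lintegral_rpow_eq_lintegral_meas_lt_mul μ (Eventually.of_forall hY0)
          hYm.aemeasurable two_pos]
        simp
    _ ≤ _ := by
        gcongr 2 * ?_
        refine setLIntegral_mono' measurableSet_Ioi fun t ht => ?_
        simp only [Set.mem_Ioi] at ht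
        have hsub : ∀ ω, t < Y ω → X ω ≤ c ∧ t < X ω := fun ω h => by
          by_cases hω : X ω ≤ c
          · simp only [hY, Set.indicator, Set.mem_ofPred_eq, if_pos hω] at h
            exact ⟨hω, h⟩
          · simp only [hY, Set.indicator, Set.mem_ofPred_eq, if_neg hω] at h
            exact absurd h ht.not_gt
        rw [show (2 : ℝ) - 1 = 1 by norm_num, Real.rpow_one]
        split_ifs with h
        · gcongr ?_ * _
          exact measure_mono fun ω hω => (hsub ω hω).2
        · have : {ω | t < Y ω} = ∅ := Set.eq_empty_of_forall_notMem fun ω hω =>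
            h ((hsub ω hω).2.trans_le (hsub ω hω).1)
          simp [this]

/-- Variance estimate in the proof of Theorem 1: for non-negative random variables with
`G x = sup_{n≥1} (1/a_n) ∑_{k=1}^n P(X_k > x)` satisfying `∫_0^∞ G < ∞`, the truncations
`Y_n = X_n · 1_{X_n ≤ a_n}` satisfy `∑_{n=1}^∞ Var(Y_n)/a_n² ≤ 16 ∫_0^∞ G(y) dy < ∞`. -/
theorem truncated_variance_sum_bound {Ω : Type*} [MeasurableSpace Ω] (μ : Measure Ω)
    [IsProbabilityMeasure μ]
    (X : ℕ → Ω → ℝ) (hmeas : ∀ n, Measurable (X n))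
    (hnonneg : ∀ n ω, 0 ≤ X n ω)
    (a : ℕ → ℝ) (ha_pos : ∀ n, 0 < a n) (ha_mono : Monotone a)
    (ha_unbdd : Tendsto a atTop atTop)
    (hG : (∫⁻ x in Set.Ioi (0 : ℝ), ⨆ n, ⨆ (_ : 1 ≤ n),
        (∑ k ∈ Finset.Icc 1 n, μ {ω | x < X k ω}) / ENNReal.ofReal (a n)) < ⊤) :
    ((∑' n : ℕ, evariance ({ω' | X (n + 1) ω' ≤ a (n + 1)}.indicator (X (n + 1))) μ
        / ENNReal.ofReal ((a (n + 1)) ^ 2))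
      ≤ 16 * ∫⁻ y in Set.Ioi (0 : ℝ), ⨆ n, ⨆ (_ : 1 ≤ n),
          (∑ k ∈ Finset.Icc 1 n, μ {ω | y < X k ω}) / ENNReal.ofReal (a n)) ∧
    (∑' n : ℕ, evariance ({ω' | X (n + 1) ω' ≤ a (n + 1)}.indicator (X (n + 1))) μ
        / ENNReal.ofReal ((a (n + 1)) ^ 2)) < ⊤ := by
  set G : ℝ → ℝ≥0∞ := fun x => ⨆ n, ⨆ (_ : 1 ≤ n),
    (∑ k ∈ Finset.Icc 1 n, μ {ω | x < X k ω}) / ENNReal.ofReal (a n) with hGdef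
  have hS : ∀ x n, 1 ≤ n →
      ∑ k ∈ Finset.Icc 1 n, μ {ω | x < X k ω} ≤ G x * ENNReal.ofReal (a n) := fun x n hn => by
    rw [← ENNReal.div_le_iff (by simpa using ha_pos n) ENNReal.ofReal_ne_top]
    exact le_iSup₂_of_le n hn le_rfl
  have hpm : ∀ n, Measurable fun t : ℝ => μ {ω | t < X n ω} := fun n =>
    Antitone.measurable fun s t hst => measure_mono fun ω hω => lt_of_le_of_lt hst hω
  have hinv : ∀ n, (ENNReal.ofReal (a (n + 1) ^ 2))⁻¹ ≠ ⊤ := fun n => by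
    simpa using (ha_pos (n + 1)).ne'
  have hmain : (∑' n : ℕ, evariance ({ω' | X (n + 1) ω' ≤ a (n + 1)}.indicator (X (n + 1))) μ
        / ENNReal.ofReal ((a (n + 1)) ^ 2)) ≤ 16 * ∫⁻ y in Set.Ioi (0 : ℝ), G y := by
    calc _ ≤ ∑' n, 2 * ∫⁻ t in Set.Ioi (0 : ℝ), (if t < a (n + 1) then
            μ {ω | t < X (n + 1) ω} / ENNReal.ofReal (a (n + 1) ^ 2) else 0)
              * ENNReal.ofReal t := by
          gcongr with n
          rw [div_eq_mul_inv]
          grw [evariance_indicator_le_le μ (hmeas (n + 1)) (hnonneg (n + 1)) (a (n + 1))]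
          rw [mul_assoc, ← lintegral_mul_const' _ _ (hinv n)]
          gcongr 2 * ?_
          refine lintegral_mono fun t => ?_
          dsimp only
          split_ifs
          · rw [div_eq_mul_inv, mul_right_comm]
          · simp
      _ = 2 * ∫⁻ t in Set.Ioi (0 : ℝ), (∑' n, if t < a (n + 1) then
            μ {ω | t < X (n + 1) ω} / ENNReal.ofReal (a (n + 1) ^ 2) else 0)
              * ENNReal.ofReal t := by
          rw [ENNReal.tsum_mul_left, ← lintegral_tsum fun n => ?_]
          · simp_rw [ENNReal.tsum_mul_right]
          · exact ((Measurable.ite measurableSet_Iio ((hpm _).div_const _)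
              measurable_const).mul ENNReal.measurable_ofReal).aemeasurable
      _ ≤ 2 * ∫⁻ t in Set.Ioi (0 : ℝ), 2 * G t := by
          gcongr 2 * ?_
          exact setLIntegral_mono' measurableSet_Ioi fun t ht =>
            tsum_ite_div_sq_mul_le ha_pos (hS t) ht
      _ = 4 * ∫⁻ t in Set.Ioi (0 : ℝ), G t := by
          rw [lintegral_const_mul' _ _ (by simp), ← mul_assoc]
          norm_num
      _ ≤ _ := by
          gcongr
          norm_num
  exact ⟨hmain, hmain.trans_lt (ENNReal.mul_lt_top (by simp) hG)⟩
end

section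
/- Let (X_n)_{n≥1} be a sequence of pairwise independent, non-negative integrable random variables and let (a_n)_{n≥1} be a non-decreasing unbounded sequence of positive real numbers. Set G(x) = sup_{n≥1} (1/a_n) ∑_{k=1}^{n} P(X_k > x) for x ≥ 0 and suppose ∫_0^∞ G(x) dx < ∞. Let Y_n = X_n · 1_{{X_n ≤ a_n}} and T_n = ∑_{k=1}^{n} Y_k. Then (T_n − E T_n)/a_n → 0 almost surely. -/
open MeasureTheory ProbabilityTheory Filter ENNReal

/-- A monotone sequence on `{0, …, N}` with values in `[0, C]` admits a `δ`-net of bracketing indices,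
whose size depends only on `C / δ`. -/
lemma exists_bracketing_net {e : ℕ → ℝ} (he : Monotone e) (h0 : ∀ n, 0 ≤ e n) {N : ℕ} {C δ : ℝ}
    (hC : e N ≤ C) (hδ : 0 < δ) :
    ∃ F : Finset ℕ, F.card ≤ 2 * (⌊C / δ⌋₊ + 1) ∧ (∀ p ∈ F, p ≤ N) ∧
      ∀ n ≤ N, ∃ p ∈ F, ∃ q ∈ F, p ≤ n ∧ n ≤ q ∧ e q - e p ≤ δ := by
  classical
  let A : ℕ → Set ℕ := fun s => {n | n ≤ N ∧ ⌊e n / δ⌋₊ = s}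
  have hbdd : ∀ s, BddAbove (A s) := fun s => ⟨N, fun n hn => hn.1⟩
  let R := Finset.range (⌊C / δ⌋₊ + 1)
  refine ⟨R.image (fun s => sInf (A s)) ∪ R.image (fun s => sSup (A s)), ?_, ?_, ?_⟩
  · refine (Finset.card_union_le _ _).trans ?_
    have h1 := Finset.card_image_le (s := R) (f := fun s => sInf (A s))
    have h2 := Finset.card_image_le (s := R) (f := fun s => sSup (A s))
    have h3 : R.card = ⌊C / δ⌋₊ + 1 := Finset.card_range _
    omega
  · intro p hp
    rcases Finset.mem_union.1 hp with h | h
    · obtain ⟨s, -, rfl⟩ := Finset.mem_image.1 h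
      rcases (A s).eq_empty_or_nonempty with h | h
      · simp [h]
      · exact (Nat.sInf_mem h).1
    · obtain ⟨s, -, rfl⟩ := Finset.mem_image.1 h
      rcases (A s).eq_empty_or_nonempty with h | h
      · simp [h]
      · exact (Nat.sSup_mem h (hbdd s)).1
  · intro n hn
    have hmem : n ∈ A ⌊e n / δ⌋₊ := ⟨hn, rfl⟩
    have hR : ⌊e n / δ⌋₊ ∈ R := by
      refine Finset.mem_range.2 (Nat.lt_succ_of_le (Nat.floor_mono ?_))
      gcongr
      exact (he hn).trans hC
    refine ⟨_, Finset.mem_union_left _ (Finset.mem_image_of_mem _ hR), _,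
      Finset.mem_union_right _ (Finset.mem_image_of_mem _ hR), Nat.sInf_le hmem,
      le_csSup (hbdd _) hmem, ?_⟩
    have hp := (Nat.sInf_mem ⟨n, hmem⟩).2
    have hq := (Nat.sSup_mem ⟨n, hmem⟩ (hbdd _)).2
    set p := sInf (A ⌊e n / δ⌋₊)
    set q := sSup (A ⌊e n / δ⌋₊)
    have h1 := Nat.floor_le (div_nonneg (h0 p) hδ.le)
    have h2 := Nat.lt_floor_add_one (e q / δ)
    rw [hp] at h1
    rw [hq] at h2
    have h3 : e q / δ - e p / δ < 1 := by linarith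
    rw [← sub_div, div_lt_one hδ] at h3
    exact h3.le

/-- A maximal inequality for partial sums of pairwise independent non-negative random variables. -/
lemma measure_exists_le_abs_sum_sub_integral_le {Ω : Type*} [MeasurableSpace Ω] {μ : Measure Ω}
    [IsProbabilityMeasure μ] {Y : ℕ → Ω → ℝ} (hY : ∀ k, MemLp (Y k) 2 μ)
    (hnonneg : ∀ k ω, 0 ≤ Y k ω) (hindep : ∀ i j, i ≠ j → IndepFun (Y i) (Y j) μ)
    {N : ℕ} {C δ : ℝ} (hC : ∫ ω, ∑ k ∈ Finset.Icc 1 N, Y k ω ∂μ ≤ C) (hδ : 0 < δ) :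
    μ {ω | ∃ n ≤ N, 2 * δ ≤
        |∑ k ∈ Finset.Icc 1 n, Y k ω - ∫ ω', ∑ k ∈ Finset.Icc 1 n, Y k ω' ∂μ|} ≤
      ((2 * (⌊C / δ⌋₊ + 1) : ℕ) : ℝ≥0∞) *
        ((∑ k ∈ Finset.Icc 1 N, ∫⁻ ω, ENNReal.ofReal (Y k ω ^ (2 : ℝ)) ∂μ) /
          ENNReal.ofReal (δ ^ 2)) := by
  set T : ℕ → Ω → ℝ := fun n ω => ∑ k ∈ Finset.Icc 1 n, Y k ω with hT
  set e : ℕ → ℝ := fun n => ∫ ω, T n ω ∂μ with he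
  have hTL : ∀ n, MemLp (T n) 2 μ := fun n => memLp_finsetSum _ fun k _ => hY k
  have hTi : ∀ n, Integrable (T n) μ := fun n => (hTL n).integrable (by norm_num)
  have hTmono : ∀ ω, Monotone fun n => T n ω := fun ω m n hmn =>
    Finset.sum_le_sum_of_subset_of_nonneg (Finset.Icc_subset_Icc_right hmn)
      fun k _ _ => hnonneg k ω
  have hemono : Monotone e := fun m n hmn =>
    integral_mono (hTi m) (hTi n) fun ω => hTmono ω hmn
  have he0 : ∀ n, 0 ≤ e n := fun n =>
    integral_nonneg fun ω => Finset.sum_nonneg fun k _ => hnonneg k ω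
  obtain ⟨F, hFcard, hFN, hF⟩ := exists_bracketing_net hemono he0 hC hδ
  set V := ∑ k ∈ Finset.Icc 1 N, ∫⁻ ω, ENNReal.ofReal (Y k ω ^ (2 : ℝ)) ∂μ with hV
  have hcheb : ∀ p ∈ F, μ {ω | δ ≤ |T p ω - e p|} ≤ V / ENNReal.ofReal (δ ^ 2) := by
    intro p hp
    refine (meas_ge_le_variance_div_sq (hTL p) hδ).trans ?_
    rw [ENNReal.ofReal_div_of_pos (by positivity)]
    gcongr
    have hTp : T p = ∑ k ∈ Finset.Icc 1 p, Y k := by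
      ext ω; simp [hT]
    rw [hTp, IndepFun.variance_sum (fun k _ => hY k) (fun i _ j _ hij => hindep i j hij),
      ENNReal.ofReal_sum_of_nonneg fun k _ => variance_nonneg _ _]
    refine (Finset.sum_le_sum fun k _ => ?_).trans
      (Finset.sum_le_sum_of_subset (Finset.Icc_subset_Icc_right (hFN p hp)))
    refine (ENNReal.ofReal_le_ofReal
      (variance_le_expectation_sq (hY k).aestronglyMeasurable)).trans (le_of_eq ?_)
    simp_rw [Pi.pow_apply]
    rw [ofReal_integral_eq_lintegral_ofReal (hY k).integrable_sq
      (Eventually.of_forall fun ω => by simp [sq_nonneg])]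
    simp
  have hsub : {ω | ∃ n ≤ N, 2 * δ ≤ |T n ω - e n|} ⊆ ⋃ p ∈ F, {ω | δ ≤ |T p ω - e p|} := by
    rintro ω ⟨n, hn, hω⟩
    by_contra hcon
    simp only [Set.mem_iUnion, Set.mem_ofPred_eq, not_exists, not_le] at hcon
    obtain ⟨p, hp, q, hq, hpn, hnq, hpq⟩ := hF n hn
    have h1 := abs_lt.1 (hcon p hp)
    have h2 := abs_lt.1 (hcon q hq)
    have h3 : T p ω ≤ T n ω := hTmono ω hpn
    have h4 : T n ω ≤ T q ω := hTmono ω hnq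
    have h5 := hemono hpn
    have h6 := hemono hnq
    have : |T n ω - e n| < 2 * δ := abs_lt.2 ⟨by linarith, by linarith⟩
    linarith
  calc _ ≤ ∑ p ∈ F, μ {ω | δ ≤ |T p ω - e p|} :=
        (measure_mono hsub).trans (measure_biUnion_finset_le _ _)
    _ ≤ ∑ p ∈ F, V / ENNReal.ofReal (δ ^ 2) := Finset.sum_le_sum hcheb
    _ ≤ _ := by
      rw [Finset.sum_const, nsmul_eq_mul]
      gcongr

lemma tsum_ite_lt_two_pow_le (t : ℝ) :
    ∑' m : ℕ, (if t < 2 ^ (m + 1) then ENNReal.ofReal t * 2⁻¹ ^ m else 0) ≤ 4 := by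
  classical
  have hex : ∃ m : ℕ, t < 2 ^ (m + 1) := by
    obtain ⟨m, hm⟩ := pow_unbounded_of_one_lt t _root_.one_lt_two
    exact ⟨m, hm.trans_le (pow_le_pow_right₀ one_le_two (Nat.le_succ m))⟩
  obtain ⟨r, hspec, hmin⟩ : ∃ r : ℕ, t < 2 ^ (r + 1) ∧ ∀ m < r, ¬ t < 2 ^ (m + 1) :=
    ⟨Nat.find hex, Nat.find_spec hex, fun _ => Nat.find_min hex⟩
  have h1 : ENNReal.ofReal t ≤ 2 ^ (r + 1) :=
    (ENNReal.ofReal_le_ofReal hspec.le).trans (le_of_eq (by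
      rw [ENNReal.ofReal_pow (by norm_num)]; norm_num))
  have hterm : ∀ m, ENNReal.ofReal t * 2⁻¹ ^ (m + r) ≤ 2 * 2⁻¹ ^ m := fun m =>
    calc _ ≤ (2 : ℝ≥0∞) ^ (r + 1) * 2⁻¹ ^ (m + r) := by gcongr
      _ = (2 * 2⁻¹) ^ r * (2 * 2⁻¹ ^ m) := by rw [mul_pow]; ring
      _ = 2 * 2⁻¹ ^ m := by
        rw [ENNReal.mul_inv_cancel (by norm_num) (by norm_num)]; simp
  set f : ℕ → ℝ≥0∞ := fun m => if t < 2 ^ (m + 1) then ENNReal.ofReal t * 2⁻¹ ^ m else 0 with hf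
  have hzero : ∑ m ∈ Finset.range r, f m = 0 :=
    Finset.sum_eq_zero fun m hm => if_neg (hmin m (Finset.mem_range.1 hm))
  have hle : ∀ m, f (m + r) ≤ 2 * 2⁻¹ ^ m := by
    intro m
    simp only [hf]
    split_ifs
    · exact hterm m
    · exact zero_le
  have hsplit : ∑' m, f m = ∑' m, f (m + r) := by
    rw [← (ENNReal.summable (f := fun m => f (m + r))).sum_add_tsum_nat_add', hzero, zero_add]
  calc ∑' m, f m ≤ ∑' m : ℕ, (2 : ℝ≥0∞) * 2⁻¹ ^ m := hsplit ▸ ENNReal.tsum_le_tsum hle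
    _ = 2 * 2 := by rw [ENNReal.tsum_mul_left, ENNReal.tsum_geometric_two]
    _ = 4 := by norm_num

/-- Truncation of a random variable at level `c` only decreases the tail, and removes it above
`c`. -/
lemma measure_lt_indicator_le {Ω : Type*} [MeasurableSpace Ω] (μ : Measure Ω) (X : Ω → ℝ)
    {b c t : ℝ} (hbc : b ≤ c) (ht : 0 < t) :
    μ {ω | t < {ω' | X ω' ≤ b}.indicator X ω} ≤ if t < c then μ {ω | t < X ω} else 0 := by
  have key : ∀ ω, t < {ω' | X ω' ≤ b}.indicator X ω → t < X ω ∧ t < c := by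
    intro ω hω
    by_cases h : X ω ≤ b
    · rw [Set.indicator_of_mem (by exact h)] at hω
      exact ⟨hω, hω.trans_le (h.trans hbc)⟩
    · rw [Set.indicator_of_notMem (by exact h)] at hω
      exact absurd hω ht.not_gt
  split_ifs with h
  · exact measure_mono fun ω hω => (key ω hω).1
  · refine (measure_mono fun ω hω => ?_).trans measure_empty.le
    exact h (key ω hω).2

/-- Step (3.7) of the proof of Theorem 1: for pairwise independent non-negative integrable
random variables with `∫_0^∞ G < ∞`, where `G x = sup_{n≥1} (1/a_n) ∑_{k=1}^n P(X_k > x)`,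
the truncated sums `T_n = ∑_{k=1}^n X_k · 1_{X_k ≤ a_k}` satisfy `(T_n - E T_n)/a_n → 0` a.s. -/
theorem truncated_sums_slln {Ω : Type*} [MeasurableSpace Ω] (μ : Measure Ω)
    [IsProbabilityMeasure μ]
    (X : ℕ → Ω → ℝ) (hmeas : ∀ n, Measurable (X n))
    (hnonneg : ∀ n ω, 0 ≤ X n ω)
    (hindep : ∀ i j, i ≠ j → IndepFun (X i) (X j) μ)
    (hint : ∀ n, 1 ≤ n → Integrable (X n) μ)
    (a : ℕ → ℝ) (ha_pos : ∀ n, 0 < a n) (ha_mono : Monotone a)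
    (ha_unbdd : Tendsto a atTop atTop)
    (hG : (∫⁻ x in Set.Ioi (0 : ℝ), ⨆ n, ⨆ (_ : 1 ≤ n),
        (∑ k ∈ Finset.Icc 1 n, μ {ω | x < X k ω}) / ENNReal.ofReal (a n)) < ⊤) :
    ∀ᵐ ω ∂μ, Tendsto
      (fun n : ℕ => ((∑ k ∈ Finset.Icc 1 n, ({ω' | X k ω' ≤ a k}.indicator (X k)) ω)
        - ∫ ω', ∑ k ∈ Finset.Icc 1 n, ({ω'' | X k ω'' ≤ a k}.indicator (X k)) ω' ∂μ) / a n)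
      atTop (nhds 0) := by
  set G : ℝ → ℝ≥0∞ := fun x => ⨆ n, ⨆ (_ : 1 ≤ n),
    (∑ k ∈ Finset.Icc 1 n, μ {ω | x < X k ω}) / ENNReal.ofReal (a n) with hGdef
  have hGmeas : Measurable G := by
    refine Measurable.iSup fun n => Measurable.iSup fun _ => Measurable.div_const ?_ _
    refine Finset.measurable_sum _ fun k _ => Antitone.measurable ?_
    exact fun x y hxy => measure_mono fun ω hω => lt_of_le_of_lt hxy hω
  have hGle : ∀ n, 1 ≤ n → ∀ x, ∑ k ∈ Finset.Icc 1 n, μ {ω | x < X k ω} ≤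
      ENNReal.ofReal (a n) * G x := by
    intro n hn x
    rw [mul_comm, ← ENNReal.div_le_iff (by simpa using ha_pos n) ENNReal.ofReal_ne_top]
    exact le_iSup₂_of_le n hn le_rfl
  set M := (∫⁻ x in Set.Ioi (0 : ℝ), G x).toReal with hM
  set Y : ℕ → Ω → ℝ := fun k => {ω | X k ω ≤ a k}.indicator (X k) with hYdef
  have hYmeas : ∀ k, Measurable (Y k) := fun k =>
    (hmeas k).indicator (measurableSet_le (hmeas k) measurable_const)
  have hY0 : ∀ k ω, 0 ≤ Y k ω := fun k ω => Set.indicator_nonneg (fun ω _ => hnonneg k ω) ω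
  have hYle : ∀ k ω, Y k ω ≤ a k := fun k ω =>
    Set.indicator_le' (fun ω h => h) (fun _ _ => (ha_pos k).le) ω
  have hYL : ∀ k, MemLp (Y k) 2 μ := fun k =>
    MemLp.of_bound (hYmeas k).aestronglyMeasurable (a k)
      (Eventually.of_forall fun ω => by rw [Real.norm_of_nonneg (hY0 k ω)]; exact hYle k ω)
  have hYindep : ∀ i j, i ≠ j → IndepFun (Y i) (Y j) μ := by
    intro i j hij
    have hφ : ∀ k, Measurable ({x : ℝ | x ≤ a k}.indicator id) := fun k =>
      measurable_id.indicator measurableSet_Iic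
    exact (hindep i j hij).comp (hφ i) (hφ j)
  have hmoment : ∀ n, 1 ≤ n → ∀ c, a n ≤ c →
      ∑ k ∈ Finset.Icc 1 n, ∫⁻ ω, ENNReal.ofReal (Y k ω ^ (2 : ℝ)) ∂μ ≤
        2 * ∫⁻ t in Set.Ioi (0 : ℝ),
          (if t < c then ENNReal.ofReal c * G t * ENNReal.ofReal t else 0) := by
    intro n hn c hc
    have h1 : ∀ k, ∫⁻ ω, ENNReal.ofReal (Y k ω ^ (2 : ℝ)) ∂μ =
        2 * ∫⁻ t in Set.Ioi (0 : ℝ), μ {ω | t < Y k ω} * ENNReal.ofReal t := by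
      intro k
      rw [lintegral_rpow_eq_lintegral_meas_lt_mul μ (Eventually.of_forall (hY0 k))
        (hYmeas k).aemeasurable two_pos]
      norm_num
    simp_rw [h1]
    rw [← Finset.mul_sum, ← lintegral_finsetSum']
    · gcongr 2 * ?_
      refine setLIntegral_mono' measurableSet_Ioi fun t ht => ?_
      have h2 : ∀ k ∈ Finset.Icc 1 n, μ {ω | t < Y k ω} * ENNReal.ofReal t ≤
          (if t < c then μ {ω | t < X k ω} else 0) * ENNReal.ofReal t := fun k hk => by
        gcongr
        exact measure_lt_indicator_le μ (X k)
          ((ha_mono (Finset.mem_Icc.1 hk).2).trans hc) ht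
      refine (Finset.sum_le_sum h2).trans ?_
      split_ifs with h
      · rw [← Finset.sum_mul]
        gcongr
        exact (hGle n hn t).trans (by gcongr)
      · simp
    · intro k _
      refine (Measurable.mul (Antitone.measurable ?_) ENNReal.measurable_ofReal).aemeasurable
      exact fun x y hxy => measure_mono fun ω hω => lt_of_le_of_lt hxy hω
  have hmean : ∀ n, 1 ≤ n → ∫ ω, ∑ k ∈ Finset.Icc 1 n, Y k ω ∂μ ≤ a n * M := by
    intro n hn
    have hS : ∀ ω, 0 ≤ ∑ k ∈ Finset.Icc 1 n, Y k ω := fun ω =>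
      Finset.sum_nonneg fun k _ => hY0 k ω
    rw [integral_eq_lintegral_of_nonneg_ae (Eventually.of_forall hS)
      (Finset.measurable_sum _ fun k _ => hYmeas k).aestronglyMeasurable, hM,
      ← ENNReal.toReal_ofReal (ha_pos n).le, ← ENNReal.toReal_mul]
    refine ENNReal.toReal_mono (ENNReal.mul_ne_top ENNReal.ofReal_ne_top hG.ne) ?_
    simp_rw [fun ω => ENNReal.ofReal_sum_of_nonneg (s := Finset.Icc 1 n) fun k _ => hY0 k ω]
    rw [lintegral_finsetSum _ fun k _ => (hYmeas k).ennreal_ofReal,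
      ← lintegral_const_mul _ hGmeas]
    simp_rw [fun k => lintegral_eq_lintegral_meas_lt μ (Eventually.of_forall (hY0 k))
      (hYmeas k).aemeasurable]
    rw [← lintegral_finsetSum']
    · refine setLIntegral_mono' measurableSet_Ioi fun t ht => ?_
      refine (Finset.sum_le_sum fun k hk => ?_).trans (hGle n hn t)
      refine (measure_lt_indicator_le μ (X k) le_rfl ht).trans ?_
      split_ifs
      · exact le_rfl
      · exact zero_le
    · intro k _
      refine (Antitone.measurable ?_).aemeasurable
      exact fun x y hxy => measure_mono fun ω hω => lt_of_le_of_lt hxy hω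
  have hM0 : 0 ≤ M := ENNReal.toReal_nonneg
  have hblock : ∀ m : ℕ, ∃ N : ℕ, ∀ n, 1 ≤ n → (a n < 2 ^ (m + 1) ↔ n ≤ N) := by
    intro m
    classical
    have hex : ∃ n, (2 : ℝ) ^ (m + 1) ≤ a n := (ha_unbdd.eventually_ge_atTop _).exists
    refine ⟨Nat.find hex - 1, fun n hn => ⟨fun h => ?_, fun h => ?_⟩⟩
    · by_contra hcon
      exact absurd ((Nat.find_spec hex).trans (ha_mono (by omega : Nat.find hex ≤ n))) h.not_ge
    · exact not_le.1 (Nat.find_min hex (by omega))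
  choose N hN using hblock
  have hmain : ∀ ε : ℝ, 0 < ε → ∀ᵐ ω ∂μ, ∀ᶠ n in atTop,
      |∑ k ∈ Finset.Icc 1 n, Y k ω - ∫ ω', ∑ k ∈ Finset.Icc 1 n, Y k ω' ∂μ| < 2 * ε * a n := by
    intro ε hε
    have hprob : ∀ m, μ {ω | ∃ n ≤ N m, 2 * (ε * 2 ^ m) ≤
        |∑ k ∈ Finset.Icc 1 n, Y k ω - ∫ ω', ∑ k ∈ Finset.Icc 1 n, Y k ω' ∂μ|} ≤
        ((2 * (⌊2 * M / ε⌋₊ + 1) : ℕ) : ℝ≥0∞) * (ENNReal.ofReal (4 / ε ^ 2) *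
          ∫⁻ t in Set.Ioi (0 : ℝ),
            (if t < 2 ^ (m + 1) then ENNReal.ofReal t * 2⁻¹ ^ m else 0) * G t) := by
      intro m
      have hC : ∫ ω, ∑ k ∈ Finset.Icc 1 (N m), Y k ω ∂μ ≤ 2 ^ (m + 1) * M := by
        rcases Nat.eq_zero_or_pos (N m) with h | h
        · rw [h]
          simpa using by positivity
        · refine (hmean _ h).trans ?_
          gcongr
          exact ((hN m _ h).2 le_rfl).le
      refine (measure_exists_le_abs_sum_sub_integral_le hYL hY0 hYindep hC
        (by positivity : 0 < ε * 2 ^ m)).trans ?_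
      rw [show (2 : ℝ) ^ (m + 1) * M / (ε * 2 ^ m) = 2 * M / ε by field_simp; ring]
      gcongr _ * ?_
      rcases Nat.eq_zero_or_pos (N m) with h | h
      · simp [h]
      have hconst : 2 * ENNReal.ofReal (2 ^ (m + 1)) / ENNReal.ofReal ((ε * 2 ^ m) ^ 2) =
          ENNReal.ofReal (4 / ε ^ 2) * 2⁻¹ ^ m := by
        have h2 : (2 : ℝ≥0∞) = ENNReal.ofReal 2 := by norm_num
        rw [h2, ← ENNReal.ofReal_inv_of_pos two_pos, ← ENNReal.ofReal_pow (by norm_num),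
          ← ENNReal.ofReal_mul (by norm_num), ← ENNReal.ofReal_div_of_pos (by positivity),
          ← ENNReal.ofReal_mul (by positivity)]
        congr 1
        rw [inv_pow]
        field_simp
        ring
      calc _ ≤ (2 * ∫⁻ t in Set.Ioi (0 : ℝ), (if t < 2 ^ (m + 1) then
              ENNReal.ofReal (2 ^ (m + 1)) * G t * ENNReal.ofReal t else 0)) /
              ENNReal.ofReal ((ε * 2 ^ m) ^ 2) := by
            gcongr
            exact hmoment _ h _ ((hN m _ h).2 le_rfl).le
        _ = (2 * ENNReal.ofReal (2 ^ (m + 1)) / ENNReal.ofReal ((ε * 2 ^ m) ^ 2)) *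
            ∫⁻ t in Set.Ioi (0 : ℝ), (if t < 2 ^ (m + 1) then ENNReal.ofReal t else 0) * G t := by
          have h3 : ∀ t : ℝ, (if t < 2 ^ (m + 1) then
              ENNReal.ofReal (2 ^ (m + 1)) * G t * ENNReal.ofReal t else 0) =
              ENNReal.ofReal (2 ^ (m + 1)) *
                ((if t < 2 ^ (m + 1) then ENNReal.ofReal t else 0) * G t) := by
            intro t
            split_ifs
            · ring
            · simp
          simp_rw [h3]
          rw [lintegral_const_mul' _ _ ENNReal.ofReal_ne_top]
          simp only [div_eq_mul_inv]
          ring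
        _ = _ := by
          rw [hconst, mul_assoc, ← lintegral_const_mul' _ _ (by simp)]
          congr 2
          ext t
          split_ifs
          · ring
          · simp
    have hsum : ∑' m, μ {ω | ∃ n ≤ N m, 2 * (ε * 2 ^ m) ≤
        |∑ k ∈ Finset.Icc 1 n, Y k ω - ∫ ω', ∑ k ∈ Finset.Icc 1 n, Y k ω' ∂μ|} ≠ ⊤ := by
      refine ne_top_of_le_ne_top ?_ (ENNReal.tsum_le_tsum hprob)
      rw [ENNReal.tsum_mul_left, ENNReal.tsum_mul_left]
      refine ENNReal.mul_ne_top (ENNReal.natCast_ne_top _)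
        (ENNReal.mul_ne_top ENNReal.ofReal_ne_top ?_)
      rw [← lintegral_tsum]
      · simp_rw [ENNReal.tsum_mul_right]
        refine ne_top_of_le_ne_top (ENNReal.mul_ne_top (by norm_num : (4 : ℝ≥0∞) ≠ ⊤) hG.ne) ?_
        rw [← lintegral_const_mul _ hGmeas]
        exact lintegral_mono fun t => by gcongr; exact tsum_ite_lt_two_pow_le t
      · intro m
        exact ((Measurable.ite measurableSet_Iio (ENNReal.measurable_ofReal.mul_const _)
          measurable_const).mul hGmeas).aemeasurable
    filter_upwards [ae_eventually_notMem hsum] with ω hω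
    obtain ⟨m₀, hm₀⟩ := eventually_atTop.1 hω
    filter_upwards [ha_unbdd.eventually_ge_atTop (2 ^ m₀), eventually_ge_atTop 1] with n hn hn1
    obtain ⟨m, hm1, hm2⟩ := exists_nat_pow_near
      ((one_le_pow₀ one_le_two).trans hn) (one_lt_two (α := ℝ))
    have hmm : m₀ < m + 1 := (pow_lt_pow_iff_right₀ _root_.one_lt_two).1 (hn.trans_lt hm2)
    have := hm₀ m (by omega)
    simp only [not_exists, not_and, not_le] at this
    refine (this n ((hN m n hn1).1 hm2)).trans_le ?_
    rw [mul_assoc]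
    gcongr
  have hall := ae_all_iff.2 fun j : ℕ => hmain (1 / (j + 1)) (by positivity)
  filter_upwards [hall] with ω hω
  rw [Metric.tendsto_atTop']
  intro ε hε
  obtain ⟨j, hj⟩ := exists_nat_one_div_lt (half_pos hε)
  obtain ⟨n₀, hn₀⟩ := eventually_atTop.1 (hω j)
  refine ⟨n₀, fun n hn => ?_⟩
  rw [Real.dist_eq, sub_zero, abs_div, abs_of_pos (ha_pos n), div_lt_iff₀ (ha_pos n)]
  refine (hn₀ n hn.le).trans_le ?_
  have := ha_pos n
  gcongr
  linarith
end

section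
/- Let (X_n)_{n≥1} be a sequence of real-valued random variables. Suppose there exists a function H : [0,∞) → [0,∞) that is non-increasing on [0,∞), satisfies ∫_0^∞ H(x) dx < ∞, and satisfies sup_{n≥1} (1/n) ∑_{k=1}^{n} P(|X_k| > x) ≤ H(x) for all x ≥ 0. Then ∑_{n=1}^∞ P(|X_n| > n) < ∞. -/
open MeasureTheory ProbabilityTheory Filter ENNReal

/-- A series in `ℝ≥0∞` is bounded by the sum of bounds on its dyadic blocks. -/
theorem tsum_succ_le_of_dyadic_block_le {a b : ℕ → ℝ≥0∞}
    (h : ∀ j, ∑ k ∈ Finset.Ico (2 ^ j) (2 ^ (j + 1)), a k ≤ b j) :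
    ∑' n, a (n + 1) ≤ ∑' j, b j := by
  have block_sum (N : ℕ) :
      ∑ k ∈ Finset.Ico 1 (2 ^ N), a k ≤ ∑ j ∈ Finset.range N, b j := by
    induction N with
    | zero => simp
    | succ N ih =>
      rw [← Finset.sum_Ico_consecutive a Nat.one_le_two_pow
        (Nat.pow_le_pow_right two_pos N.le_succ), Finset.sum_range_succ]
      exact add_le_add ih (h N)
  refine ENNReal.tsum_le_of_sum_range_le fun n ↦ ?_
  calc ∑ i ∈ Finset.range n, a (i + 1) = ∑ k ∈ Finset.Ico 1 (n + 1), a k := by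
        rw [Finset.range_eq_Ico, Finset.sum_Ico_add' a 0 n 1, zero_add]
    _ ≤ ∑ k ∈ Finset.Ico 1 (2 ^ n), a k :=
        Finset.sum_le_sum_of_subset (Finset.Ico_subset_Ico_right Nat.lt_two_pow_self)
    _ ≤ ∑ j ∈ Finset.range n, b j := block_sum n
    _ ≤ ∑' j, b j := ENNReal.sum_le_tsum _

/-- An integrable antitone nonnegative function on `[0, ∞)` has a summable condensed series. -/
theorem AntitoneOn.summable_two_pow_mul {H : ℝ → ℝ} (anti : AntitoneOn H (Set.Ici 0))
    (integrable : IntegrableOn H (Set.Ici 0)) (nonneg : ∀ x ∈ Set.Ici (0 : ℝ), 0 ≤ H x) :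
    Summable fun j : ℕ ↦ (2 : ℝ) ^ j * H (2 ^ j) := by
  have key := (summable_condensed_iff_of_nonneg (f := fun n : ℕ ↦ H n)
    (fun n ↦ nonneg n (Set.mem_Ici.2 n.cast_nonneg))
    (fun m n _ hmn ↦ anti (Set.mem_Ici.2 m.cast_nonneg) (Set.mem_Ici.2 n.cast_nonneg)
      (Nat.cast_le.2 hmn))).2
    (anti.summable_of_integrableOn_Ioi_zero (integrable.mono_set Set.Ioi_subset_Ici_self)
      fun t ht ↦ nonneg t (Set.Ioi_subset_Ici_self ht))
  simpa using key

/-- Step in the proof of Theorem 2: if `sup_{n≥1} (1/n) ∑_{k=1}^n P(|X_k| > x) ≤ H x` for a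
non-negative non-increasing function `H` on `[0,∞)` with `∫_0^∞ H < ∞`, then
`∑_{n=1}^∞ P(|X_n| > n) < ∞`. -/
theorem tail_sum_finite_of_dominated {Ω : Type*} [MeasurableSpace Ω] (μ : Measure Ω)
    [IsProbabilityMeasure μ]
    (X : ℕ → Ω → ℝ) (hmeas : ∀ n, Measurable (X n))
    (H : ℝ → ℝ) (hH_nonneg : ∀ x ∈ Set.Ici (0 : ℝ), 0 ≤ H x)
    (hH_anti : AntitoneOn H (Set.Ici (0 : ℝ)))
    (hH_int : IntegrableOn H (Set.Ici (0 : ℝ)) volume)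
    (hdom : ∀ x : ℝ, 0 ≤ x →
      (⨆ n, ⨆ (_ : 1 ≤ n), (∑ k ∈ Finset.Icc 1 n, μ {ω | x < |X k ω|}) / (n : ℝ≥0∞))
        ≤ ENNReal.ofReal (H x)) :
    (∑' n : ℕ, μ {ω | ((n + 1 : ℕ) : ℝ) < |X (n + 1) ω|}) < ⊤ := by
  have sum_tail_le (n : ℕ) (hn : 1 ≤ n) (x : ℝ) (hx : 0 ≤ x) :
      ∑ k ∈ Finset.Icc 1 n, μ {ω | x < |X k ω|} ≤ ENNReal.ofReal (n * H x) := by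
    have h := (le_iSup₂ (f := fun (n : ℕ) (_ : 1 ≤ n) ↦
      (∑ k ∈ Finset.Icc 1 n, μ {ω | x < |X k ω|}) / (n : ℝ≥0∞)) n hn).trans (hdom x hx)
    rw [ENNReal.div_le_iff (by positivity) (ENNReal.natCast_ne_top n)] at h
    rwa [mul_comm (n : ℝ), ENNReal.ofReal_mul (hH_nonneg x hx), ENNReal.ofReal_natCast]
  have block_le (j : ℕ) :
      ∑ k ∈ Finset.Ico ((2 : ℕ) ^ j) (2 ^ (j + 1)), μ {ω | (k : ℝ) < |X k ω|} ≤
        ENNReal.ofReal (2 * (2 ^ j * H (2 ^ j))) := by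
    calc _ ≤ ∑ k ∈ Finset.Ico (2 ^ j) (2 ^ (j + 1)), μ {ω | (2 : ℝ) ^ j < |X k ω|} := by
          refine Finset.sum_le_sum fun k hk ↦ measure_mono fun ω hω ↦ ?_
          have hk' : (2 : ℝ) ^ j ≤ k := mod_cast (Finset.mem_Ico.1 hk).1
          exact hk'.trans_lt hω
      _ ≤ ∑ k ∈ Finset.Icc 1 (2 ^ (j + 1)), μ {ω | (2 : ℝ) ^ j < |X k ω|} := by
          refine Finset.sum_le_sum_of_subset fun k hk ↦ ?_
          rw [Finset.mem_Ico] at hk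
          exact Finset.mem_Icc.2 ⟨Nat.one_le_two_pow.trans hk.1, hk.2.le⟩
      _ ≤ _ := sum_tail_le _ Nat.one_le_two_pow _ (by positivity)
      _ = _ := by
          congr 1
          push_cast
          ring
  exact (tsum_succ_le_of_dyadic_block_le block_le).trans_lt
    ((hH_anti.summable_two_pow_mul hH_int hH_nonneg).mul_left 2).tsum_ofReal_lt_top
end
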